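/- Let K be a tetrahedron, s > 1/2 and v ∈ H^s(curl;K). Then the curl-conforming interpolant of the second kind and the divergence-conforming interpolant of the first kind commute with the curl: ∇×(I_h^curl v) = I_h^div(∇×v). -/

import Mathlib

noncomputable section

open MeasureTheory

/-- Points of `ℝ³`. -/
abbrev R3 := Fin 3 → ℝ
/-- Vectors of `ℂ³`. -/
abbrev C3 := Fin 3 → ℂ

/-- Complexification of a real vector. -/
def cR (x : R3) : C3 := fun i => (x i : ℂ)

/-- The complex pairing `a ⬝ conj b`. -/
def dotC (a b : C3) : ℂ := ∑ i, a i * (starRingEnd ℂ) (b i)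

/-- The real dot product. -/
def dotR (a b : R3) : ℝ := ∑ i, a i * b i

/-- `n ⬝ a` for a real vector `n` and a complex vector `a` (no conjugation). -/
def ndot (n : R3) (a : C3) : ℂ := ∑ i, (n i : ℂ) * a i

/-- The tangential component `n×a×n = a - (n⬝a)n` (for a unit vector `n`). -/
def tang (n : R3) (a : C3) : C3 := fun i => a i - ndot n a * (n i : ℂ)

/-- Partial derivative of a complex-valued field on `ℝ³`. -/
def pd (f : R3 → ℂ) (j : Fin 3) (x : R3) : ℂ := fderiv ℝ f x (Pi.single j 1)

/-- The (classical) curl of a vector field `ℝ³ → ℂ³`. -/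
def vcurl (f : R3 → C3) (x : R3) : C3 :=
  ![pd (fun y => f y 2) 1 x - pd (fun y => f y 1) 2 x,
    pd (fun y => f y 0) 2 x - pd (fun y => f y 2) 0 x,
    pd (fun y => f y 1) 0 x - pd (fun y => f y 0) 1 x]

/-- `f` is a complex polynomial of total degree `≤ k` (with `k : ℤ`, so that
`P_k = {0}`-type conditions for `k < 0` become vacuous). -/
def PolyDeg (k : ℤ) (f : R3 → ℂ) : Prop :=
  ∃ p : MvPolynomial (Fin 3) ℂ, (p.totalDegree : ℤ) ≤ k ∧
    ∀ x : R3, f x = MvPolynomial.eval (fun j => (x j : ℂ)) p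

/-- `f` is a vector polynomial in `[P_k]³`. -/
def VPolyDeg (k : ℤ) (f : R3 → C3) : Prop := ∀ i, PolyDeg k fun x => f x i

/-- `f` is a homogeneous polynomial of degree `k` (vacuous for `k < 0`). -/
def PolyHom (k : ℤ) (f : R3 → ℂ) : Prop :=
  ∃ d : ℕ, (d : ℤ) = k ∧ ∃ p : MvPolynomial (Fin 3) ℂ, p.IsHomogeneous d ∧
    ∀ x : R3, f x = MvPolynomial.eval (fun j => (x j : ℂ)) p

/-- The first-family space `D_k = [P_{k-1}]³ + P̃_{k-1} x`. -/
def DSpace (k : ℤ) (f : R3 → C3) : Prop :=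
  ∃ (g : R3 → C3) (φ : R3 → ℂ), VPolyDeg (k - 1) g ∧ PolyHom (k - 1) φ ∧
    ∀ x, f x = fun i => g x i + φ x * (x i : ℂ)

/-- `w` is the distributional (weak) curl of `v` on the open set `U`:
`∫_U v ⬝ conj(∇×φ) = ∫_U w ⬝ conj φ` for all smooth compactly supported `φ` with
support in `U`. -/
def IsWeakCurlOn (v w : R3 → C3) (U : Set R3) : Prop :=
  ∀ φ : R3 → C3, ContDiff ℝ (⊤ : ℕ∞) φ → HasCompactSupport φ → tsupport φ ⊆ U →
    ∫ x in U, dotC (v x) (vcurl φ x) = ∫ x in U, dotC (w x) (φ x)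

section

/-- The reference simplex in `ℝᵈ`. -/
def refSimplex (d : ℕ) : Set (Fin d → ℝ) := {y | (∀ i, 0 ≤ y i) ∧ ∑ i, y i ≤ 1}

/-- A cube contained in the reference simplex. -/
def refCube (d : ℕ) : Set (Fin d → ℝ) := Set.univ.pi fun _ => Set.Ioo 0 (1 / ((d : ℝ) + 1))

lemma isClosed_refSimplex (d : ℕ) : IsClosed (refSimplex d) := by
  have h : refSimplex d = (⋂ i, {y | 0 ≤ y i}) ∩ {y | ∑ i, y i ≤ 1} := by
    ext y; simp [refSimplex]
  rw [h]
  exact (isClosed_iInter fun i => isClosed_le continuous_const (continuous_apply i)).inter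
    (isClosed_le (by fun_prop) continuous_const)

lemma refSimplex_subset_Icc (d : ℕ) : refSimplex d ⊆ Set.Icc 0 1 := by
  rintro y ⟨h0, h1⟩
  exact ⟨h0, fun i => (Finset.single_le_sum (fun j _ => h0 j) (Finset.mem_univ i)).trans h1⟩

lemma isCompact_refSimplex (d : ℕ) : IsCompact (refSimplex d) :=
  isCompact_Icc.of_isClosed_subset (isClosed_refSimplex d) (refSimplex_subset_Icc d)

lemma convex_refSimplex (d : ℕ) : Convex ℝ (refSimplex d) := by
  rintro x ⟨hx0, hx1⟩ y ⟨hy0, hy1⟩ a b ha hb hab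
  refine ⟨fun i => ?_, ?_⟩
  · simpa using add_nonneg (mul_nonneg ha (hx0 i)) (mul_nonneg hb (hy0 i))
  · simp only [Pi.add_apply, Pi.smul_apply, smul_eq_mul, Finset.sum_add_distrib, ← Finset.mul_sum]
    nlinarith

lemma isOpen_refCube (d : ℕ) : IsOpen (refCube d) :=
  isOpen_set_pi Set.finite_univ fun _ _ => isOpen_Ioo

lemma refCube_nonempty (d : ℕ) : (refCube d).Nonempty := by
  refine Set.univ_pi_nonempty_iff.2 fun _ => Set.nonempty_Ioo.2 (by positivity)

lemma refCube_subset_refSimplex (d : ℕ) : refCube d ⊆ refSimplex d := by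
  intro y hy
  have hy' : ∀ i, y i ∈ Set.Ioo 0 (1 / ((d : ℝ) + 1)) := fun i => hy i (Set.mem_univ i)
  refine ⟨fun i => (hy' i).1.le, ?_⟩
  calc ∑ i, y i ≤ ∑ _i : Fin d, 1 / ((d : ℝ) + 1) := Finset.sum_le_sum fun i _ => (hy' i).2.le
    _ ≤ 1 := by
      simp only [Finset.sum_const, Finset.card_univ, Fintype.card_fin, nsmul_eq_mul]
      rw [mul_one_div, div_le_one (by positivity)]
      linarith

lemma volume_refSimplex_ne_zero (d : ℕ) : volume (refSimplex d) ≠ 0 :=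
  ((((isOpen_refCube d).measure_pos volume (refCube_nonempty d)).trans_le
    (measure_mono (refCube_subset_refSimplex d)))).ne'

lemma volume_refSimplex_ne_top (d : ℕ) : volume (refSimplex d) ≠ ⊤ :=
  (isCompact_refSimplex d).measure_lt_top.ne

lemma refSimplex_insertNth_iff {d : ℕ} (m : Fin (d + 1)) (t : ℝ) (z : Fin d → ℝ) :
    m.insertNth (α := fun _ => ℝ) t z ∈ refSimplex (d + 1) ↔
      0 ≤ t ∧ (∀ i, 0 ≤ z i) ∧ t ≤ 1 - ∑ i, z i := by
  simp only [refSimplex, Set.mem_ofPred_eq, Fin.forall_iff_succAbove m, Fin.insertNth_apply_same,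
    Fin.insertNth_apply_succAbove, Fin.sum_univ_succAbove _ m]
  constructor
  · rintro ⟨⟨a, b⟩, c⟩; exact ⟨a, b, by linarith⟩
  · rintro ⟨a, b, c⟩; exact ⟨⟨a, b⟩, by linarith⟩

variable {E : Type*} [AddCommGroup E] [Module ℝ E]

/-- The affine parametrization of the simplex with vertices `p`, based at the vertex `j`. -/
def simplexParam {d : ℕ} (p : Fin (d + 1) → E) (j : Fin (d + 1)) (y : Fin d → ℝ) : E :=
  p j + Fintype.linearCombination ℝ (fun i => p (j.succAbove i) - p j) y

lemma simplexParam_apply {d : ℕ} (p : Fin (d + 1) → E) (j : Fin (d + 1)) (y : Fin d → ℝ) :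
    simplexParam p j y = p j + ∑ i, y i • (p (j.succAbove i) - p j) := by
  simp [simplexParam, Fintype.linearCombination_apply]

lemma image_simplexParam {d : ℕ} (p : Fin (d + 1) → E) (j : Fin (d + 1)) :
    simplexParam p j '' refSimplex d = convexHull ℝ (Set.range p) := by
  apply subset_antisymm
  · rintro _ ⟨y, hy, rfl⟩
    refine mem_convexHull_of_exists_fintype (j.insertNth (α := fun _ => ℝ) (1 - ∑ i, y i) y) p
      ?_ ?_ (fun i => Set.mem_range_self i) ?_
    · rw [Fin.forall_iff_succAbove j]
      refine ⟨?_, fun i => ?_⟩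
      · simpa using hy.2
      · simpa using hy.1 i
    · simp [Fin.sum_univ_succAbove _ j]
    · simp only [Fin.sum_univ_succAbove _ j, Fin.insertNth_apply_same,
        Fin.insertNth_apply_succAbove, simplexParam_apply, smul_sub, Finset.sum_sub_distrib,
        sub_smul, one_smul, Finset.sum_smul]
      abel
  · refine convexHull_min ?_ ?_
    · rintro _ ⟨i, rfl⟩
      obtain rfl | ⟨m, rfl⟩ := Fin.eq_self_or_eq_succAbove j i
      · exact ⟨0, ⟨fun _ => le_rfl, by simp⟩, by simp [simplexParam]⟩
      · refine ⟨Pi.single m 1, ⟨fun i => ?_, by simp⟩, ?_⟩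
        · by_cases h : i = m
          · subst h; simp
          · simp [h]
        · simp [simplexParam]
    · have h : simplexParam p j '' refSimplex d = (fun x => p j + x) ''
          (Fintype.linearCombination ℝ (fun i => p (j.succAbove i) - p j) '' refSimplex d) := by
        rw [Set.image_image]; rfl
      rw [h]
      exact ((convex_refSimplex d).linear_image _).translate (p j)

lemma simplexParam_linear_injective {d : ℕ} {p : Fin (d + 1) → E} (hp : AffineIndependent ℝ p)
    (j : Fin (d + 1)) :
    Function.Injective (Fintype.linearCombination ℝ (fun i => p (j.succAbove i) - p j)) := by
  rw [← linearIndependent_iff_injective_fintypeLinearCombination]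
  have h := (affineIndependent_iff_linearIndependent_vsub ℝ p j).1 hp
  exact h.comp (fun i => ⟨j.succAbove i, Fin.succAbove_ne j i⟩)
    fun a b hab => by simpa using hab

lemma simplexParam_insertNth_zero {d : ℕ} (p : Fin (d + 2) → E) (j : Fin (d + 2))
    (m : Fin (d + 1)) (z : Fin d → ℝ) :
    simplexParam p j (m.insertNth (α := fun _ => ℝ) 0 z) =
      simplexParam (p ∘ (j.succAbove m).succAbove) (m.predAbove j) z := by
  simp only [simplexParam_apply, Fin.sum_univ_succAbove _ m, Fin.insertNth_apply_same,
    Fin.insertNth_apply_succAbove, zero_smul, zero_add, Function.comp,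
    Fin.succAbove_succAbove_predAbove, Fin.succAbove_succAbove_succAbove_predAbove]

lemma simplexParam_insertNth_slant {d : ℕ} (p : Fin (d + 2) → E) (j : Fin (d + 2))
    (m : Fin (d + 1)) (z : Fin d → ℝ) :
    simplexParam p j (m.insertNth (α := fun _ => ℝ) (1 - ∑ i, z i) z) =
      simplexParam (p ∘ j.succAbove) m z := by
  simp only [simplexParam_apply, Fin.sum_univ_succAbove _ m, Fin.insertNth_apply_same,
    Fin.insertNth_apply_succAbove, Function.comp, smul_sub, Finset.sum_sub_distrib,
        sub_smul, one_smul, Finset.sum_smul]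
  abel

end

section

/-- The Hausdorff measure of dimension `d` pulled back along an injective linear map from `ℝᵈ`
is a positive multiple of Lebesgue measure. -/
lemma exists_comap_hausdorffMeasure_eq_smul {E : Type*} [NormedAddCommGroup E] [NormedSpace ℝ E]
    [MeasurableSpace E] [BorelSpace E] {d : ℕ} (f : (Fin d → ℝ) →ₗ[ℝ] E)
    (hf : Function.Injective f) (a : E) :
    MeasurableEmbedding (fun y => a + f y) ∧ ∃ c : NNReal, c ≠ 0 ∧
      Measure.comap (fun y => a + f y) (μH[(d : ℝ)] : Measure E) = c • volume := by
  obtain ⟨k, -, hk⟩ := f.exists_antilipschitzWith (LinearMap.ker_eq_bot.2 hf)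
  have hfc : Continuous f := f.continuous_of_finiteDimensional
  have hk' : AntilipschitzWith k (fun y => a + f y) := fun x y => by
    simpa using hk x y
  have hlip : LipschitzWith ‖f.toContinuousLinearMap‖₊ (fun y => a + f y) := fun x y => by
    simpa using f.toContinuousLinearMap.lipschitz x y
  have hemb : MeasurableEmbedding (fun y => a + f y) :=
    (hk'.isClosedEmbedding hlip.uniformContinuous).measurableEmbedding
  refine ⟨hemb, ?_⟩
  set ν := Measure.comap (fun y => a + f y) (μH[(d : ℝ)] : Measure E) with hν
  have hvol : (μH[(d : ℝ)] : Measure (Fin d → ℝ)) = volume := by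
    simpa using hausdorffMeasure_pi_real (ι := Fin d)
  have happ : ∀ s, ν s = μH[(d : ℝ)] ((fun y => a + f y) '' s) := fun s => hemb.comap_apply _ s
  have hfin : IsFiniteMeasureOnCompacts ν := ⟨fun s hs => by
    rw [happ]
    refine (hlip.hausdorffMeasure_image_le (Nat.cast_nonneg d) s).trans_lt ?_
    rw [hvol]
    exact ENNReal.mul_lt_top (by simp) hs.measure_lt_top⟩
  have hinv : ν.IsAddLeftInvariant := ⟨fun g => by
    ext s hs
    rw [Measure.map_apply (measurable_const_add g) hs, happ, happ,
      ← (IsometryEquiv.addLeft (f g)).hausdorffMeasure_image]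
    congr 1
    rw [Set.image_image]
    ext x
    constructor
    · rintro ⟨y, hy, rfl⟩
      refine ⟨g + y, hy, ?_⟩
      change a + f (g + y) = f g + (a + f y)
      rw [map_add]; abel
    · rintro ⟨y, hy, rfl⟩
      refine ⟨-g + y, by simpa using hy, ?_⟩
      change f g + (a + f (-g + y)) = a + f y
      rw [map_add, map_neg]; abel⟩
  refine ⟨ν.addHaarScalarFactor volume, fun h0 => ?_, Measure.isAddLeftInvariant_eq_smul ν volume⟩
  have h1 : ν = 0 := by
    rw [Measure.isAddLeftInvariant_eq_smul ν volume, h0, zero_smul]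
  have h2 := hk'.le_hausdorffMeasure_image (d := (d : ℝ)) (Nat.cast_nonneg d) (refSimplex d)
  rw [← happ, h1, hvol] at h2
  exact volume_refSimplex_ne_zero d (by simpa using h2)

lemma isCompact_convexHull_range {E : Type*} [NormedAddCommGroup E] [NormedSpace ℝ E] {d : ℕ}
    (p : Fin (d + 1) → E) : IsCompact (convexHull ℝ (Set.range p)) :=
  (Set.finite_range p).isCompact_convexHull ℝ

variable {E F : Type*} [NormedAddCommGroup E] [NormedSpace ℝ E]
    [MeasurableSpace E] [BorelSpace E] [NormedAddCommGroup F] [NormedSpace ℝ F]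

/-- Averages over a simplex, with respect to the Hausdorff measure, computed in the reference
simplex. -/
lemma setAverage_convexHull_eq {d : ℕ} {p : Fin (d + 1) → E} (hp : AffineIndependent ℝ p)
    (j : Fin (d + 1)) (G : E → F) :
    ⨍ x in convexHull ℝ (Set.range p), G x ∂μH[(d : ℝ)] =
      ⨍ y in refSimplex d, G (simplexParam p j y) := by
  obtain ⟨hemb, c, hc, h⟩ := exists_comap_hausdorffMeasure_eq_smul
    (Fintype.linearCombination ℝ (fun i => p (j.succAbove i) - p j))
    (simplexParam_linear_injective hp j) (p j)
  change MeasurableEmbedding (simplexParam p j) at hemb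
  change Measure.comap (simplexParam p j) _ = _ at h
  have hS := (isClosed_refSimplex d).measurableSet
  have hrestr : (μH[(d : ℝ)] : Measure E).restrict (convexHull ℝ (Set.range p)) =
      Measure.map (simplexParam p j) (c • volume.restrict (refSimplex d)) := by
    rw [← Measure.restrict_smul, ← h, hemb.restrict_comap, hemb.map_comap,
      image_simplexParam, Measure.restrict_restrict hemb.measurableSet_range,
      Set.inter_eq_right.2]
    rw [← image_simplexParam p j]; exact Set.image_subset_range _ _
  rw [hrestr, average_eq, hemb.integral_map, average_eq, integral_smul_nnreal_measure,
    measureReal_def, Measure.map_apply hemb.measurable MeasurableSet.univ, Set.preimage_univ,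
    Measure.smul_apply, measureReal_def, ENNReal.smul_def, smul_eq_mul, ENNReal.toReal_mul,
    NNReal.smul_def, smul_smul, ENNReal.coe_toReal, mul_inv, mul_right_comm,
    inv_mul_cancel₀ (by exact_mod_cast hc), one_mul]

lemma hausdorffMeasure_convexHull_lt_top {d : ℕ} {p : Fin (d + 1) → E}
    (hp : AffineIndependent ℝ p) : μH[(d : ℝ)] (convexHull ℝ (Set.range p)) < ⊤ := by
  obtain ⟨hemb, c, hc, h⟩ := exists_comap_hausdorffMeasure_eq_smul
    (Fintype.linearCombination ℝ (fun i => p ((0 : Fin (d + 1)).succAbove i) - p 0))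
    (simplexParam_linear_injective hp 0) (p 0)
  rw [← image_simplexParam p 0]
  change MeasurableEmbedding (simplexParam p 0) at hemb
  change Measure.comap (simplexParam p 0) _ = _ at h
  rw [← hemb.comap_apply, h]
  simpa using ENNReal.mul_lt_top ENNReal.coe_lt_top (volume_refSimplex_ne_top d).lt_top

lemma integrableOn_convexHull {d : ℕ} {p : Fin (d + 1) → E} (hp : AffineIndependent ℝ p)
    {G : E → ℂ} (hG : ContinuousOn G (convexHull ℝ (Set.range p))) :
    IntegrableOn G (convexHull ℝ (Set.range p)) μH[(d : ℝ)] := by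
  have hc := isCompact_convexHull_range p
  obtain ⟨C, hC⟩ := hc.exists_bound_of_continuousOn hG
  have : IsFiniteMeasure ((μH[(d : ℝ)] : Measure E).restrict (convexHull ℝ (Set.range p))) :=
    isFiniteMeasure_restrict.2 (hausdorffMeasure_convexHull_lt_top hp).ne
  exact Integrable.of_bound (hG.aestronglyMeasurable_of_isCompact hc hc.measurableSet) C
    ((ae_restrict_iff' hc.measurableSet).2 (Filter.Eventually.of_forall hC))

end

section

/-- Integrating a partial derivative over the reference simplex. -/
lemma integral_refSimplex_fderiv {d : ℕ} {H : (Fin (d + 1) → ℝ) → ℂ} (hH : ContDiff ℝ 1 H)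
    (m : Fin (d + 1)) :
    ∫ y in refSimplex (d + 1), fderiv ℝ H y (Pi.single m 1) =
      ∫ z in refSimplex d, (H (m.insertNth (α := fun _ => ℝ) (1 - ∑ i, z i) z) -
        H (m.insertNth (α := fun _ => ℝ) 0 z)) := by
  set g : (Fin (d + 1) → ℝ) → ℂ := fun y => fderiv ℝ H y (Pi.single m 1) with hg
  have hgc : Continuous g := (hH.continuous_fderiv one_ne_zero).clm_apply continuous_const
  have hS := (isClosed_refSimplex (d + 1)).measurableSet
  have hint : Integrable ((refSimplex (d + 1)).indicator g) :=
    (integrable_indicator_iff hS).2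
      (hgc.continuousOn.integrableOn_compact (isCompact_refSimplex _))
  have he := (volume_preserving_piFinSuccAbove (fun _ : Fin (d + 1) => ℝ) m).symm
  have hsymm : ∀ q : ℝ × (Fin d → ℝ), (MeasurableEquiv.piFinSuccAbove (fun _ => ℝ) m).symm q =
      m.insertNth (α := fun _ => ℝ) q.1 q.2 := fun q => rfl
  rw [← integral_indicator hS, ← he.integral_comp (MeasurableEquiv.measurableEmbedding _)]
  have hint' := (he.integrable_comp_emb (MeasurableEquiv.measurableEmbedding _)).2 hint
  rw [Measure.volume_eq_prod] at hint' ⊢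
  refine (integral_prod_symm _ hint').trans ?_
  rw [← integral_indicator (isClosed_refSimplex d).measurableSet]
  refine integral_congr_ae (Filter.Eventually.of_forall fun z => ?_)
  simp only [hsymm, Function.comp]
  by_cases hz : z ∈ refSimplex d
  · rw [Set.indicator_of_mem hz]
    have h1 : ∀ t, (refSimplex (d + 1)).indicator g (m.insertNth (α := fun _ => ℝ) t z) =
        (Set.Icc 0 (1 - ∑ i, z i)).indicator
          (fun t => g (m.insertNth (α := fun _ => ℝ) t z)) t := by
      intro t
      by_cases ht : t ∈ Set.Icc 0 (1 - ∑ i, z i)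
      · rw [Set.indicator_of_mem ht, Set.indicator_of_mem
          ((refSimplex_insertNth_iff m t z).2 ⟨ht.1, hz.1, ht.2⟩)]
      · rw [Set.indicator_of_notMem ht, Set.indicator_of_notMem]
        intro h
        have h2 := (refSimplex_insertNth_iff m t z).1 h
        exact ht ⟨h2.1, h2.2.2⟩
    simp only [h1]
    rw [integral_indicator measurableSet_Icc, integral_Icc_eq_integral_Ioc,
      ← intervalIntegral.integral_of_le (by linarith [hz.2])]
    obtain ⟨a, hins⟩ : ∃ a : Fin (d + 1) → ℝ, ∀ t : ℝ, m.insertNth (α := fun _ => ℝ) t z =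
        a + t • Pi.single m 1 := by
      refine ⟨m.insertNth (α := fun _ => ℝ) 0 z, fun t => ?_⟩
      ext l
      obtain rfl | ⟨l, rfl⟩ := Fin.eq_self_or_eq_succAbove m l <;> simp
    have hder : ∀ t : ℝ, HasDerivAt (fun t : ℝ => H (m.insertNth (α := fun _ => ℝ) t z))
        (g (m.insertNth (α := fun _ => ℝ) t z)) t := by
      intro t
      simp only [hins]
      have h3 : HasDerivAt (fun t : ℝ => a + t • Pi.single m 1)
          (Pi.single m 1 : Fin (d + 1) → ℝ) t := by
        simpa using ((hasDerivAt_id t).smul_const (Pi.single m 1 : Fin (d + 1) → ℝ)).const_add a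
      exact ((hH.differentiable one_ne_zero _).hasFDerivAt).comp_hasDerivAt t h3
    refine intervalIntegral.integral_eq_sub_of_hasDerivAt (fun t _ => hder t) ?_
    refine Continuous.intervalIntegrable ?_ _ _
    simp only [hins]
    fun_prop
  · rw [Set.indicator_of_notMem hz]
    refine integral_eq_zero_of_ae (Filter.Eventually.of_forall fun t => ?_)
    refine Set.indicator_of_notMem (fun h => ?_) _
    have h2 := (refSimplex_insertNth_iff m t z).1 h
    exact hz ⟨h2.2.1, by linarith [h2.1, h2.2.2]⟩

/-- The ratio between the volumes of two consecutive reference simplices. -/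
def simplexRatio (d : ℕ) : ℝ := (volume.real (refSimplex (d + 1)))⁻¹ * volume.real (refSimplex d)

variable {E : Type*} [NormedAddCommGroup E] [NormedSpace ℝ E] [MeasurableSpace E] [BorelSpace E]

/-- The fundamental theorem of calculus on a simplex, in the direction of an edge. -/
lemma setAverage_fderiv_edge {d : ℕ} {p : Fin (d + 2) → E} (hp : AffineIndependent ℝ p)
    {F : E → ℂ} (hF : ContDiff ℝ 1 F) (j : Fin (d + 2)) (m : Fin (d + 1)) :
    ⨍ x in convexHull ℝ (Set.range p), fderiv ℝ F x (p (j.succAbove m) - p j)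
        ∂μH[((d + 1 : ℕ) : ℝ)] =
      simplexRatio d •
        (⨍ x in convexHull ℝ (Set.range (p ∘ j.succAbove)), F x ∂μH[(d : ℝ)] -
          ⨍ x in convexHull ℝ (Set.range (p ∘ (j.succAbove m).succAbove)), F x ∂μH[(d : ℝ)]) := by
  have hinj : ∀ i : Fin (d + 2), AffineIndependent ℝ (p ∘ i.succAbove) := fun i =>
    hp.comp_embedding (Fin.succAboveEmb i)
  rw [setAverage_convexHull_eq hp j, setAverage_convexHull_eq (hinj j) m,
    setAverage_convexHull_eq (hinj (j.succAbove m)) (m.predAbove j)]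
  set L : (Fin (d + 1) → ℝ) →L[ℝ] E := (Fintype.linearCombination ℝ
    (fun i => p (j.succAbove i) - p j)).toContinuousLinearMap with hL
  have hpar : simplexParam p j = fun y => p j + L y := rfl
  have hparc : ∀ {n : ℕ} (q : Fin (n + 1) → E) (i : Fin (n + 1)), Continuous (simplexParam q i) :=
    fun q i => continuous_const.add (LinearMap.continuous_of_finiteDimensional _)
  have hH : ContDiff ℝ 1 (fun y => F (simplexParam p j y)) := by
    rw [hpar]; exact hF.comp (contDiff_const.add L.contDiff)
  have key := integral_refSimplex_fderiv hH m
  have hder : ∀ y, fderiv ℝ (fun y => F (simplexParam p j y)) y (Pi.single m 1) =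
      fderiv ℝ F (simplexParam p j y) (p (j.succAbove m) - p j) := by
    intro y
    have h1 : HasFDerivAt (simplexParam p j) L y := by
      rw [hpar]; exact L.hasFDerivAt.const_add _
    have h2 := ((hF.differentiable one_ne_zero (simplexParam p j y)).hasFDerivAt).comp y h1
    rw [show (fun y => F (simplexParam p j y)) = F ∘ simplexParam p j from rfl, h2.fderiv]
    simp [hL]
  simp only [hder, simplexParam_insertNth_zero, simplexParam_insertNth_slant] at key
  have hi : ∀ (q : Fin (d + 1) → E) (i : Fin (d + 1)),
      IntegrableOn (fun z => F (simplexParam q i z)) (refSimplex d) := fun q i =>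
    (hF.continuous.comp (hparc q i)).continuousOn.integrableOn_compact (isCompact_refSimplex d)
  rw [integral_sub (hi _ _) (hi _ _)] at key
  rw [setAverage_eq, setAverage_eq, setAverage_eq, key, ← smul_sub, smul_smul, simplexRatio,
    mul_assoc, mul_inv_cancel₀, mul_one]
  exact ENNReal.toReal_ne_zero.2 ⟨volume_refSimplex_ne_zero d, volume_refSimplex_ne_top d⟩

end

lemma fderiv_eq_sum_pd (f : R3 → ℂ) (x b : R3) :
    fderiv ℝ f x b = ∑ j, (b j : ℂ) * pd f j x := by
  have h : ∀ j : Fin 3, (fun i => if j = i then (1 : ℝ) else 0) = Pi.single j 1 := fun j => by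
    ext i; simp [Pi.single_apply, eq_comm]
  conv_lhs => rw [← (fderiv ℝ f x).coe_coe, LinearMap.pi_apply_eq_sum_univ _ b]
  simp only [h, pd, Complex.real_smul, ContinuousLinearMap.coe_coe]

lemma pd_mul {f g : R3 → ℂ} {x : R3} (hf : DifferentiableAt ℝ f x) (hg : DifferentiableAt ℝ g x)
    (j : Fin 3) : pd (fun y => f y * g y) j x = pd f j x * g x + f x * pd g j x := by
  simp only [pd, fderiv_fun_mul hf hg]
  simp; ring

lemma pd_sub {f g : R3 → ℂ} {x : R3} (hf : DifferentiableAt ℝ f x) (hg : DifferentiableAt ℝ g x)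
    (j : Fin 3) : pd (fun y => f y - g y) j x = pd f j x - pd g j x := by
  simp only [pd, fderiv_fun_sub hf hg]
  simp

lemma continuous_pd {f : R3 → ℂ} (hf : ContDiff ℝ 1 f) (j : Fin 3) : Continuous (pd f j) :=
  (hf.continuous_fderiv one_ne_zero).clm_apply continuous_const

lemma continuous_vcurl {f : R3 → C3} (hf : ContDiff ℝ 1 f) : Continuous (vcurl f) := by
  have h := fun i j => continuous_pd (contDiff_pi.1 hf i) j
  refine continuous_pi fun i => ?_
  fin_cases i <;> simp only [vcurl] <;> exact (h _ _).sub (h _ _)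

lemma contDiff_ndot {G : R3 → C3} (hG : ContDiff ℝ 1 G) (n : R3) :
    ContDiff ℝ 1 fun x => ndot n (G x) := by
  have h := contDiff_pi.1 hG
  unfold ndot
  fun_prop

lemma fderiv_ndot {G : R3 → C3} (hG : ContDiff ℝ 1 G) (n x b : R3) :
    fderiv ℝ (fun x => ndot n (G x)) x b =
      ∑ i, ∑ j, (n i : ℂ) * ((b j : ℂ) * pd (fun y => G y i) j x) := by
  have h := fun i => (contDiff_pi.1 hG i).differentiable one_ne_zero x
  unfold ndot
  rw [fderiv_fun_sum fun i _ => (h i).const_mul _]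
  simp only [sum_apply]
  refine Finset.sum_congr rfl fun i _ => ?_
  rw [fderiv_const_mul (h i), smul_apply, fderiv_eq_sum_pd, smul_eq_mul,
    Finset.mul_sum]

/-- Gradients of the barycentric coordinates of a tetrahedron, as multiples of face normals. -/
lemma exists_barycentric_gradients {vt nrm : Fin 4 → R3}
    (hn_orth : ∀ σ, ∀ i, i ≠ σ → ∀ j, j ≠ σ → dotR (nrm σ) (vt i - vt j) = 0)
    (hn_out : ∀ σ, ∀ i, i ≠ σ → dotR (nrm σ) (vt σ - vt i) < 0) :
    ∃ (g : Fin 3 → R3) (c : Fin 4 → ℝ), (∀ m, g m = c m.succ • nrm m.succ) ∧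
      (∑ m, g m = c 0 • nrm 0) ∧
      (∀ m l, dotR (g m) (vt l.succ - vt 0) = if m = l then 1 else 0) ∧
      ∀ i j, ∑ m, g m i * (vt m.succ - vt 0) j = if i = j then 1 else 0 := by
  have hne : ∀ m : Fin 3, dotR (nrm m.succ) (vt m.succ - vt 0) ≠ 0 := fun m =>
    (hn_out m.succ 0 (Fin.succ_ne_zero m).symm).ne
  set g : Fin 3 → R3 := fun m => (dotR (nrm m.succ) (vt m.succ - vt 0))⁻¹ • nrm m.succ with hg
  have hsmul : ∀ (c : ℝ) (a b : R3), dotR (c • a) b = c * dotR a b := fun c a b => by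
    simp [dotR, Finset.mul_sum, mul_assoc]
  have hdual : ∀ m l, dotR (g m) (vt l.succ - vt 0) = if m = l then 1 else 0 := by
    intro m l
    rw [hg, hsmul]
    split_ifs with h
    · subst h; exact inv_mul_cancel₀ (hne m)
    · rw [hn_orth m.succ l.succ (fun h' => h (Fin.succ_injective _ h').symm) 0
        (Fin.succ_ne_zero m).symm, mul_zero]
  have hinv : ∀ i j, ∑ m, g m i * (vt m.succ - vt 0) j = if i = j then 1 else 0 := by
    have h1 : (Matrix.of g) * (Matrix.of fun (j m : Fin 3) => (vt m.succ - vt 0) j) = 1 := by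
      ext m l
      simpa [Matrix.mul_apply, Matrix.one_apply, dotR] using hdual m l
    have h2 := mul_eq_one_comm.1 h1
    intro i j
    have h3 := congrFun (congrFun h2 j) i
    rw [Matrix.mul_apply, Matrix.one_apply] at h3
    simp only [Matrix.of_apply] at h3
    rw [if_congr (eq_comm (a := i)) rfl rfl, ← h3]
    exact Finset.sum_congr rfl fun m _ => mul_comm _ _
  have h0 : ∀ m : Fin 3, dotR (nrm 0) (vt m.succ - vt 0) = dotR (nrm 0) (vt 1 - vt 0) := by
    intro m
    have h := hn_orth 0 m.succ (Fin.succ_ne_zero m) 1 (by decide)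
    simp only [dotR, Pi.sub_apply, Fin.sum_univ_three] at h ⊢
    linarith
  have h0' : dotR (nrm 0) (vt 1 - vt 0) ≠ 0 := by
    have h := hn_out 0 1 (by decide)
    simp only [dotR, Pi.sub_apply, Fin.sum_univ_three] at h ⊢
    intro h'; linarith
  refine ⟨g, Fin.cons (α := fun _ => ℝ) (dotR (nrm 0) (vt 1 - vt 0))⁻¹
    fun m : Fin 3 => (dotR (nrm m.succ) (vt m.succ - vt 0))⁻¹, fun m => rfl, ?_, hdual, hinv⟩
  rw [Fin.cons_zero, eq_inv_smul_iff₀ h0']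
  ext i
  have h4 : nrm 0 i = ∑ m, g m i * dotR (nrm 0) (vt m.succ - vt 0) := by
    simp only [dotR, Finset.mul_sum]
    rw [Finset.sum_comm]
    have h5 : ∀ j, ∑ m, g m i * (nrm 0 j * (vt m.succ - vt 0) j) =
        if i = j then nrm 0 j else 0 := by
      intro j
      rw [← mul_boole, ← hinv i j, Finset.mul_sum]
      exact Finset.sum_congr rfl fun m _ => by ring
    rw [Finset.sum_congr rfl fun j _ => h5 j]
    simp
  rw [h4]
  simp only [h0, ← Finset.sum_mul]
  simp [mul_comm]

lemma hausdorffMeasure_three_eq_volume : (μH[((2 + 1 : ℕ) : ℝ)] : Measure R3) = volume := by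
  simpa using hausdorffMeasure_pi_real (ι := Fin 3)

/-- The divergence theorem on a tetrahedron, with unspecified face weights. -/
lemma exists_setAverage_divergence {vt nrm : Fin 4 → R3} (hvt : AffineIndependent ℝ vt)
    (hn_orth : ∀ σ, ∀ i, i ≠ σ → ∀ j, j ≠ σ → dotR (nrm σ) (vt i - vt j) = 0)
    (hn_out : ∀ σ, ∀ i, i ≠ σ → dotR (nrm σ) (vt σ - vt i) < 0) :
    ∃ κ : Fin 4 → ℂ, ∀ G : R3 → C3, ContDiff ℝ 1 G →
      ⨍ x in convexHull ℝ (Set.range vt), ∑ i, pd (fun y => G y i) i x =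
        ∑ σ, κ σ * ⨍ x in convexHull ℝ (Set.range (vt ∘ σ.succAbove)),
          ndot (nrm σ) (G x) ∂μH[((2 : ℕ) : ℝ)] := by
  obtain ⟨g, c, hgc, hg0, -, hinv⟩ := exists_barycentric_gradients hn_orth hn_out
  refine ⟨fun σ => if σ = 0 then simplexRatio 2 * c 0 else - (simplexRatio 2 * c σ),
    fun G hG => ?_⟩
  have hinj : ∀ i : Fin 4, AffineIndependent ℝ (vt ∘ i.succAbove) := fun i =>
    hvt.comp_embedding (Fin.succAboveEmb i)
  have hlin : ∀ (a : ℝ) (n : R3) (y : C3), ndot (a • n) y = a * ndot n y := fun a n y => by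
    simp [ndot, Finset.mul_sum, mul_assoc]
  have hsum : ∀ (y : C3), ndot (∑ m, g m) y = ∑ m, ndot (g m) y := fun y => by
    simp only [ndot, Finset.sum_apply, Complex.ofReal_sum, Finset.sum_mul]
    rw [Finset.sum_comm]
  have h1 : ∀ x, ∑ i, pd (fun y => G y i) i x =
      ∑ m : Fin 3, fderiv ℝ (fun x => ndot (g m) (G x)) x (vt ((0 : Fin 4).succAbove m) - vt 0) := by
    intro x
    simp only [fderiv_ndot hG, Fin.zero_succAbove]
    rw [Finset.sum_comm]
    refine Finset.sum_congr rfl fun i _ => ?_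
    rw [Finset.sum_comm]
    have h2 : ∀ j, ∑ m, (g m i : ℂ) * (((vt m.succ - vt 0) j : ℝ) * pd (fun y => G y i) j x) =
        if i = j then pd (fun y => G y i) j x else 0 := by
      intro j
      have h3 := congrArg (fun r : ℝ => (r : ℂ)) (hinv i j)
      simp only [Complex.ofReal_sum, Complex.ofReal_mul] at h3
      simp only [← mul_assoc, ← Finset.sum_mul]
      rw [h3]
      split_ifs <;> simp
    rw [Finset.sum_congr rfl fun j _ => h2 j]
    simp
  have hC : ∀ m, ContDiff ℝ 1 fun x => ndot (g m) (G x) := fun m => contDiff_ndot hG _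
  have hint : ∀ m : Fin 3, IntegrableOn (fun x => fderiv ℝ (fun x => ndot (g m) (G x)) x
      (vt ((0 : Fin 4).succAbove m) - vt 0)) (convexHull ℝ (Set.range vt)) μH[((2 + 1 : ℕ) : ℝ)] :=
    fun m => integrableOn_convexHull hvt
      (((hC m).continuous_fderiv one_ne_zero).clm_apply continuous_const).continuousOn
  have hint' : ∀ m, IntegrableOn (fun x => ndot (g m) (G x))
      (convexHull ℝ (Set.range (vt ∘ (0 : Fin 4).succAbove))) μH[((2 : ℕ) : ℝ)] :=
    fun m => integrableOn_convexHull (hinj 0) (hC m).continuous.continuousOn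
  have hstokes := fun m => setAverage_fderiv_edge hvt (hC m) 0 m
  rw [← hausdorffMeasure_three_eq_volume]
  simp only [h1]
  have h4 : ⨍ x in convexHull ℝ (Set.range vt), ∑ m : Fin 3, fderiv ℝ (fun x => ndot (g m) (G x)) x
      (vt ((0 : Fin 4).succAbove m) - vt 0) ∂μH[((2 + 1 : ℕ) : ℝ)] =
      ∑ m : Fin 3, ⨍ x in convexHull ℝ (Set.range vt), fderiv ℝ (fun x => ndot (g m) (G x)) x
      (vt ((0 : Fin 4).succAbove m) - vt 0) ∂μH[((2 + 1 : ℕ) : ℝ)] := by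
    simp only [setAverage_eq]
    rw [integral_finsetSum _ fun m _ => hint m, Finset.smul_sum]
  have h5 : ∑ m, ⨍ x in convexHull ℝ (Set.range (vt ∘ (0 : Fin 4).succAbove)), ndot (g m) (G x)
        ∂μH[((2 : ℕ) : ℝ)] = c 0 * ⨍ x in convexHull ℝ (Set.range (vt ∘ (0 : Fin 4).succAbove)),
          ndot (nrm 0) (G x) ∂μH[((2 : ℕ) : ℝ)] := by
    simp only [setAverage_eq]
    rw [← Finset.smul_sum, ← integral_finsetSum _ fun m _ => hint' m]
    simp only [← hsum, hg0, hlin]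
    rw [integral_const_mul, mul_smul_comm]
  rw [h4, Finset.sum_congr rfl fun m _ => hstokes m, ← Finset.smul_sum, Finset.sum_sub_distrib, h5,
    Fin.sum_univ_succ (n := 3)]
  simp only [Fin.succ_ne_zero, if_true, if_false, hgc, hlin, Fin.zero_succAbove]
  have h6 : ∀ m : Fin 3, ⨍ x in convexHull ℝ (Set.range (vt ∘ m.succ.succAbove)),
      (c m.succ : ℂ) * ndot (nrm m.succ) (G x) ∂μH[((2 : ℕ) : ℝ)] =
      c m.succ * ⨍ x in convexHull ℝ (Set.range (vt ∘ m.succ.succAbove)),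
        ndot (nrm m.succ) (G x) ∂μH[((2 : ℕ) : ℝ)] := fun m => by
    simp only [setAverage_eq]
    rw [integral_const_mul, mul_smul_comm]
  simp only [h6, Complex.real_smul, neg_mul, Finset.sum_neg_distrib]
  rw [mul_sub, Finset.mul_sum, sub_eq_add_neg]
  simp only [mul_assoc]

/-- A vector orthogonal to the edges of a triangle is a multiple of their cross product. -/
lemma exists_eq_smul_cross {s t n : R3} (hst : LinearIndependent ℝ ![s, t])
    (hs : dotR n s = 0) (ht : dotR n t = 0) : ∃ γ : ℝ, n = γ • crossProduct s t := by
  have hN : crossProduct s t ≠ 0 := crossProduct_ne_zero_iff_linearIndependent.2 hst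
  have hNN : dotR (crossProduct s t) (crossProduct s t) ≠ 0 := by
    intro h
    exact hN (dotProduct_self_eq_zero.1 h)
  refine ⟨(dotR (crossProduct s t) (crossProduct s t))⁻¹ * dotR n (crossProduct s t), ?_⟩
  rw [mul_smul, eq_inv_smul_iff₀ hNN]
  simp only [dotR, Fin.sum_univ_three] at hs ht
  ext i
  fin_cases i <;>
    simp [dotR, Fin.sum_univ_three, cross_apply]
  · linear_combination ((s 2 * t 0 - s 0 * t 2) * s 2 - (s 0 * t 1 - s 1 * t 0) * s 1) * ht -
      ((s 2 * t 0 - s 0 * t 2) * t 2 - (s 0 * t 1 - s 1 * t 0) * t 1) * hs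
  · linear_combination ((s 0 * t 1 - s 1 * t 0) * s 0 - (s 1 * t 2 - s 2 * t 1) * s 2) * ht -
      ((s 0 * t 1 - s 1 * t 0) * t 0 - (s 1 * t 2 - s 2 * t 1) * t 2) * hs
  · linear_combination ((s 1 * t 2 - s 2 * t 1) * s 1 - (s 2 * t 0 - s 0 * t 2) * s 0) * ht -
      ((s 1 * t 2 - s 2 * t 1) * t 1 - (s 2 * t 0 - s 0 * t 2) * t 0) * hs

/-- Stokes' theorem on a triangle, with an unspecified common weight. -/
lemma exists_setAverage_ndot_vcurl {p : Fin 3 → R3} (hp : AffineIndependent ℝ p) {n : R3}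
    (hn : ∀ i j, dotR n (p i - p j) = 0) :
    ∃ κ : ℂ, ∀ G : R3 → C3, ContDiff ℝ 1 G →
      ⨍ x in convexHull ℝ (Set.range p), ndot n (vcurl G x) ∂μH[((2 : ℕ) : ℝ)] =
        κ * ((⨍ x in convexHull ℝ (Set.range (p ∘ (0 : Fin 3).succAbove)),
            ndot (p 2 - p 1) (G x) ∂μH[((1 : ℕ) : ℝ)]) -
          (⨍ x in convexHull ℝ (Set.range (p ∘ (1 : Fin 3).succAbove)),
            ndot (p 2 - p 0) (G x) ∂μH[((1 : ℕ) : ℝ)]) +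
          ⨍ x in convexHull ℝ (Set.range (p ∘ (2 : Fin 3).succAbove)),
            ndot (p 1 - p 0) (G x) ∂μH[((1 : ℕ) : ℝ)]) := by
  have hst : LinearIndependent ℝ ![p 1 - p 0, p 2 - p 0] := by
    have h := simplexParam_linear_injective hp 0
    rw [← linearIndependent_iff_injective_fintypeLinearCombination] at h
    have e : (fun i => p ((0 : Fin 3).succAbove i) - p 0) = ![p 1 - p 0, p 2 - p 0] := by
      ext i j
      fin_cases i <;> rfl
    rwa [e] at h
  obtain ⟨γ, hγ⟩ := exists_eq_smul_cross hst (hn 1 0) (hn 2 0)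
  refine ⟨γ * simplexRatio 1, fun G hG => ?_⟩
  have hinj : ∀ i : Fin 3, AffineIndependent ℝ (p ∘ i.succAbove) := fun i =>
    hp.comp_embedding (Fin.succAboveEmb i)
  have h1 : ∀ x, ndot n (vcurl G x) =
      γ * (fderiv ℝ (fun x => ndot (p 2 - p 0) (G x)) x (p ((0 : Fin 3).succAbove 0) - p 0) -
        fderiv ℝ (fun x => ndot (p 1 - p 0) (G x)) x (p ((0 : Fin 3).succAbove 1) - p 0)) := by
    intro x
    simp only [fderiv_ndot hG]
    rw [hγ]
    simp [ndot, Fin.sum_univ_three, vcurl, cross_apply]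
    ring
  have hC : ∀ m, ContDiff ℝ 1 fun x => ndot m (G x) := fun m => contDiff_ndot hG _
  have hint : ∀ m b : R3, IntegrableOn (fun x => fderiv ℝ (fun x => ndot m (G x)) x b)
      (convexHull ℝ (Set.range p)) μH[((1 + 1 : ℕ) : ℝ)] :=
    fun m b => integrableOn_convexHull hp
      (((hC m).continuous_fderiv one_ne_zero).clm_apply continuous_const).continuousOn
  have hint' : ∀ m, IntegrableOn (fun x => ndot m (G x))
      (convexHull ℝ (Set.range (p ∘ (0 : Fin 3).succAbove))) μH[((1 : ℕ) : ℝ)] :=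
    fun m => integrableOn_convexHull (hinj 0) (hC m).continuous.continuousOn
  have hs1 := setAverage_fderiv_edge hp (hC (p 2 - p 0)) 0 0
  have hs2 := setAverage_fderiv_edge hp (hC (p 1 - p 0)) 0 1
  simp only [h1]
  have h2 : ⨍ x in convexHull ℝ (Set.range (p ∘ (0 : Fin 3).succAbove)),
      ndot (p 2 - p 1) (G x) ∂μH[((1 : ℕ) : ℝ)] =
      (⨍ x in convexHull ℝ (Set.range (p ∘ (0 : Fin 3).succAbove)),
        ndot (p 2 - p 0) (G x) ∂μH[((1 : ℕ) : ℝ)]) -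
      ⨍ x in convexHull ℝ (Set.range (p ∘ (0 : Fin 3).succAbove)),
        ndot (p 1 - p 0) (G x) ∂μH[((1 : ℕ) : ℝ)] := by
    simp only [setAverage_eq]
    rw [← smul_sub, ← integral_sub (hint' _) (hint' _)]
    simp only [ndot, Fin.sum_univ_three, Pi.sub_apply, Complex.ofReal_sub]
    congr 2
    ext x
    ring
  have h3 : ∀ F₁ F₂ : R3 → ℂ,
      IntegrableOn F₁ (convexHull ℝ (Set.range p)) μH[((1 + 1 : ℕ) : ℝ)] →
      IntegrableOn F₂ (convexHull ℝ (Set.range p)) μH[((1 + 1 : ℕ) : ℝ)] →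
      ⨍ x in convexHull ℝ (Set.range p), γ * (F₁ x - F₂ x) ∂μH[((1 + 1 : ℕ) : ℝ)] =
      γ * ((⨍ x in convexHull ℝ (Set.range p), F₁ x ∂μH[((1 + 1 : ℕ) : ℝ)]) -
        ⨍ x in convexHull ℝ (Set.range p), F₂ x ∂μH[((1 + 1 : ℕ) : ℝ)]) := by
    intro F₁ F₂ hF₁ hF₂
    simp only [setAverage_eq]
    rw [integral_const_mul, integral_sub hF₁ hF₂, ← smul_sub, mul_smul_comm]
  refine (h3 _ _ (hint _ _) (hint _ _)).trans ?_
  rw [hs1, hs2, h2]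
  simp only [Complex.real_smul]
  have e0 : (0 : Fin 3).succAbove 0 = 1 := rfl
  have e1 : (0 : Fin 3).succAbove 1 = 2 := rfl
  rw [e0, e1]
  ring

/-- The pair `(e, d)` is a uniform limit on `K` of pairs `(f, ∇ × f)` with `f` of class `C¹`. -/
def CurlApprox (K : Set R3) (e d : R3 → C3) : Prop :=
  ∃ f : ℕ → R3 → C3, (∀ n, ContDiff ℝ 1 (f n)) ∧ TendstoUniformlyOn f e Filter.atTop K ∧
    TendstoUniformlyOn (fun n => vcurl (f n)) d Filter.atTop K

lemma tendsto_setAverage_dotProduct {d : ℕ} {p : Fin (d + 1) → R3} (hp : AffineIndependent ℝ p)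
    {K : Set R3} (hpK : convexHull ℝ (Set.range p) ⊆ K) {a : R3 → C3} (ha : Continuous a)
    {f : ℕ → R3 → C3} {e : R3 → C3} (hf : ∀ n, Continuous (f n))
    (hfe : TendstoUniformlyOn f e Filter.atTop K) :
    Filter.Tendsto (fun n => ⨍ x in convexHull ℝ (Set.range p), dotProduct (a x) (f n x)
      ∂μH[(d : ℝ)]) Filter.atTop
      (nhds (⨍ x in convexHull ℝ (Set.range p), dotProduct (a x) (e x) ∂μH[(d : ℝ)])) := by
  have hc := isCompact_convexHull_range p
  have hfe' := hfe.mono hpK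
  have he : ContinuousOn e (convexHull ℝ (Set.range p)) :=
    hfe'.continuousOn (Filter.Frequently.of_forall fun n => (hf n).continuousOn)
  obtain ⟨A, hA⟩ := hc.exists_bound_of_continuousOn ha.continuousOn
  obtain ⟨B, hB⟩ := hc.exists_bound_of_continuousOn he
  have hfin : IsFiniteMeasure ((μH[(d : ℝ)] : Measure R3).restrict
      (convexHull ℝ (Set.range p))) :=
    isFiniteMeasure_restrict.2 (hausdorffMeasure_convexHull_lt_top hp).ne
  simp only [setAverage_eq]
  refine Filter.Tendsto.const_smul ?_ _
  refine tendsto_integral_filter_of_dominated_convergence (fun _ => 3 * (A * (B + 1))) ?_ ?_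
    (integrable_const _) ?_
  · refine Filter.Eventually.of_forall fun n => Continuous.aestronglyMeasurable ?_
    have := hf n
    simp only [dotProduct]
    fun_prop
  · filter_upwards [Metric.tendstoUniformlyOn_iff.1 hfe' 1 one_pos] with n hn
    refine (ae_restrict_iff' hc.measurableSet).2 (Filter.Eventually.of_forall fun x hx => ?_)
    have h1 : ‖f n x‖ ≤ B + 1 := by
      have h2 := hn x hx
      rw [dist_comm, dist_eq_norm] at h2
      have h3 := norm_le_norm_add_norm_sub' (f n x) (e x)
      linarith [hB x hx]
    calc ‖dotProduct (a x) (f n x)‖ ≤ ∑ i : Fin 3, ‖a x i * f n x i‖ := norm_sum_le _ _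
      _ ≤ ∑ _i : Fin 3, A * (B + 1) := by
        refine Finset.sum_le_sum fun i _ => ?_
        rw [norm_mul]
        exact mul_le_mul ((norm_le_pi_norm _ _).trans (hA x hx))
          ((norm_le_pi_norm _ _).trans h1) (norm_nonneg _) ((norm_nonneg _).trans (hA x hx))
      _ = 3 * (A * (B + 1)) := by simp
  · refine (ae_restrict_iff' hc.measurableSet).2 (Filter.Eventually.of_forall fun x hx => ?_)
    have h1 := tendsto_pi_nhds.1 (hfe'.tendsto_at hx)
    simp only [dotProduct]
    exact tendsto_finsetSum _ fun i _ => (h1 i).const_mul _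

lemma integrableOn_dotProduct {d : ℕ} {p : Fin (d + 1) → R3} (hp : AffineIndependent ℝ p)
    {a f : R3 → C3} (ha : Continuous a) (hf : ContinuousOn f (convexHull ℝ (Set.range p))) :
    IntegrableOn (fun x => dotProduct (a x) (f x)) (convexHull ℝ (Set.range p)) μH[(d : ℝ)] := by
  refine integrableOn_convexHull hp ?_
  have h1 := fun i => (continuous_pi_iff.1 ha i).continuousOn (s := convexHull ℝ (Set.range p))
  have h2 := continuousOn_pi.1 hf
  simp only [dotProduct]
  exact continuousOn_finsetSum _ fun i _ => (h1 i).mul (h2 i)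

lemma continuous_cross {a b : R3 → C3} (ha : Continuous a) (hb : Continuous b) :
    Continuous fun x => crossProduct (a x) (b x) := by
  simp only [cross_apply]
  refine continuous_pi fun i => ?_
  fin_cases i <;> simp <;> fun_prop

lemma contDiff_cross {a b : R3 → C3} (ha : ContDiff ℝ 1 a) (hb : ContDiff ℝ 1 b) :
    ContDiff ℝ 1 fun x => crossProduct (a x) (b x) := by
  have ha' := contDiff_pi.1 ha
  have hb' := contDiff_pi.1 hb
  simp only [cross_apply]
  refine contDiff_pi.2 fun i => ?_
  fin_cases i <;> simp <;> fun_prop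

lemma sum_pd_cross {f q : R3 → C3} (hf : ContDiff ℝ 1 f) (hq : ContDiff ℝ 1 q) (x : R3) :
    ∑ i, pd (fun y => crossProduct (f y) (q y) i) i x =
      dotProduct (q x) (vcurl f x) - dotProduct (vcurl q x) (f x) := by
  have hf' := fun i => (contDiff_pi.1 hf i).differentiable one_ne_zero x
  have hq' := fun i => (contDiff_pi.1 hq i).differentiable one_ne_zero x
  have h : ∀ i j k : Fin 3, pd (fun y => f y i * q y j - f y j * q y i) k x =
      pd (fun y => f y i) k x * q x j + f x i * pd (fun y => q y j) k x -
      (pd (fun y => f y j) k x * q x i + f x j * pd (fun y => q y i) k x) := fun i j k => by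
    rw [pd_sub (f := fun y => f y i * q y j) (g := fun y => f y j * q y i)
      ((hf' i).fun_mul (hq' j)) ((hf' j).fun_mul (hq' i)), pd_mul (hf' i) (hq' j),
      pd_mul (hf' j) (hq' i)]
  simp only [Fin.sum_univ_three, cross_apply, dotProduct, vcurl, Matrix.cons_val_zero,
    Matrix.cons_val_one, Matrix.cons_val]
  rw [h 1 2 0, h 2 0 1, h 0 1 2]
  ring

/-- The integration by parts formula for the curl on a tetrahedron. -/
lemma exists_setAverage_dotProduct_curl {vt nrm : Fin 4 → R3} (hvt : AffineIndependent ℝ vt)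
    (hn_orth : ∀ σ, ∀ i, i ≠ σ → ∀ j, j ≠ σ → dotR (nrm σ) (vt i - vt j) = 0)
    (hn_out : ∀ σ, ∀ i, i ≠ σ → dotR (nrm σ) (vt σ - vt i) < 0) :
    ∃ κ : Fin 4 → ℂ, ∀ e d q : R3 → C3, CurlApprox (convexHull ℝ (Set.range vt)) e d →
      ContDiff ℝ 1 q →
      ⨍ x in convexHull ℝ (Set.range vt), dotProduct (q x) (d x) =
        (⨍ x in convexHull ℝ (Set.range vt), dotProduct (vcurl q x) (e x)) +
        ∑ σ, κ σ * ⨍ x in convexHull ℝ (Set.range (vt ∘ σ.succAbove)),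
          dotProduct (crossProduct (q x) (cR (nrm σ))) (e x) ∂μH[((2 : ℕ) : ℝ)] := by
  obtain ⟨κ, hκ⟩ := exists_setAverage_divergence hvt hn_orth hn_out
  refine ⟨κ, fun e d q ⟨f, hf, hfe, hfd⟩ hq => ?_⟩
  have hinj : ∀ i : Fin 4, AffineIndependent ℝ (vt ∘ i.succAbove) := fun i =>
    hvt.comp_embedding (Fin.succAboveEmb i)
  have hsub : ∀ σ : Fin 4, convexHull ℝ (Set.range (vt ∘ σ.succAbove)) ⊆
      convexHull ℝ (Set.range vt) := fun σ => convexHull_mono (Set.range_comp_subset_range _ _)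
  rw [← hausdorffMeasure_three_eq_volume] at hκ ⊢
  have hcross : ∀ σ, Continuous fun x => crossProduct (q x) (cR (nrm σ)) := fun σ =>
    continuous_cross hq.continuous continuous_const
  refine tendsto_nhds_unique (tendsto_setAverage_dotProduct hvt subset_rfl hq.continuous
    (fun n => continuous_vcurl (hf n)) hfd) ?_
  have h1 : ∀ n, ⨍ x in convexHull ℝ (Set.range vt), dotProduct (q x) (vcurl (f n) x)
        ∂μH[((2 + 1 : ℕ) : ℝ)] =
      (⨍ x in convexHull ℝ (Set.range vt), dotProduct (vcurl q x) (f n x)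
        ∂μH[((2 + 1 : ℕ) : ℝ)]) +
      ∑ σ, κ σ * ⨍ x in convexHull ℝ (Set.range (vt ∘ σ.succAbove)),
        dotProduct (crossProduct (q x) (cR (nrm σ))) (f n x) ∂μH[((2 : ℕ) : ℝ)] := by
    intro n
    have h2 := hκ _ (contDiff_cross (hf n) hq)
    simp only [sum_pd_cross (hf n) hq] at h2
    have h3 : ∀ σ x, ndot (nrm σ) (crossProduct (f n x) (q x)) =
        dotProduct (crossProduct (q x) (cR (nrm σ))) (f n x) := fun σ x => by
      simp [ndot, cross_apply, dotProduct, cR, Fin.sum_univ_three]; ring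
    simp only [h3] at h2
    rw [← h2]
    simp only [setAverage_eq]
    rw [← smul_add, ← integral_add]
    · congr 2
      ext x
      ring
    · exact integrableOn_dotProduct hvt (continuous_vcurl hq) (hf n).continuous.continuousOn
    · exact (integrableOn_dotProduct hvt hq.continuous
        (continuous_vcurl (hf n)).continuousOn).sub
        (integrableOn_dotProduct hvt (continuous_vcurl hq) (hf n).continuous.continuousOn)
  simp only [h1]
  exact (tendsto_setAverage_dotProduct hvt subset_rfl (continuous_vcurl hq)
    (fun n => (hf n).continuous) hfe).add
    (tendsto_finsetSum _ fun σ _ => (tendsto_setAverage_dotProduct (hinj σ) (hsub σ) (hcross σ)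
      (fun n => (hf n).continuous) hfe).const_mul _)

/-- The integration by parts formula for the surface curl on a triangle. -/
lemma exists_setAverage_smul_curl {K : Set R3} {p : Fin 3 → R3} (hp : AffineIndependent ℝ p)
    (hpK : convexHull ℝ (Set.range p) ⊆ K) {n : R3} (hn : ∀ i j, dotR n (p i - p j) = 0) :
    ∃ κ : ℂ, ∀ (e d : R3 → C3) (φ : R3 → ℂ), CurlApprox K e d → ContDiff ℝ 1 φ →
      ⨍ x in convexHull ℝ (Set.range p), dotProduct (φ x • cR n) (d x) ∂μH[((2 : ℕ) : ℝ)] =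
        κ * ((⨍ x in convexHull ℝ (Set.range (p ∘ (0 : Fin 3).succAbove)),
            dotProduct (φ x • cR (p 2 - p 1)) (e x) ∂μH[((1 : ℕ) : ℝ)]) -
          (⨍ x in convexHull ℝ (Set.range (p ∘ (1 : Fin 3).succAbove)),
            dotProduct (φ x • cR (p 2 - p 0)) (e x) ∂μH[((1 : ℕ) : ℝ)]) +
          ⨍ x in convexHull ℝ (Set.range (p ∘ (2 : Fin 3).succAbove)),
            dotProduct (φ x • cR (p 1 - p 0)) (e x) ∂μH[((1 : ℕ) : ℝ)]) -
        ⨍ x in convexHull ℝ (Set.range p),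
          dotProduct (crossProduct (cR n) (fun j => pd φ j x)) (e x) ∂μH[((2 : ℕ) : ℝ)] := by
  obtain ⟨κ, hκ⟩ := exists_setAverage_ndot_vcurl hp hn
  refine ⟨κ, fun e d φ ⟨f, hf, hfe, hfd⟩ hφ => ?_⟩
  have hinj : ∀ i : Fin 3, AffineIndependent ℝ (p ∘ i.succAbove) := fun i =>
    hp.comp_embedding (Fin.succAboveEmb i)
  have hsub : ∀ σ : Fin 3, convexHull ℝ (Set.range (p ∘ σ.succAbove)) ⊆ K := fun σ =>
    (convexHull_mono (Set.range_comp_subset_range _ _)).trans hpK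
  have hs : ∀ b : R3, Continuous fun x => φ x • cR b := fun b =>
    hφ.continuous.smul continuous_const
  have hcross : Continuous fun x => crossProduct (cR n) (fun j => pd φ j x) :=
    continuous_cross continuous_const (continuous_pi fun j => continuous_pd hφ j)
  refine tendsto_nhds_unique (tendsto_setAverage_dotProduct hp hpK (hs n)
    (fun n => continuous_vcurl (hf n)) hfd) ?_
  have h1 : ∀ k, ⨍ x in convexHull ℝ (Set.range p), dotProduct (φ x • cR n) (vcurl (f k) x)
        ∂μH[((2 : ℕ) : ℝ)] =
      κ * ((⨍ x in convexHull ℝ (Set.range (p ∘ (0 : Fin 3).succAbove)),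
            dotProduct (φ x • cR (p 2 - p 1)) (f k x) ∂μH[((1 : ℕ) : ℝ)]) -
          (⨍ x in convexHull ℝ (Set.range (p ∘ (1 : Fin 3).succAbove)),
            dotProduct (φ x • cR (p 2 - p 0)) (f k x) ∂μH[((1 : ℕ) : ℝ)]) +
          ⨍ x in convexHull ℝ (Set.range (p ∘ (2 : Fin 3).succAbove)),
            dotProduct (φ x • cR (p 1 - p 0)) (f k x) ∂μH[((1 : ℕ) : ℝ)]) -
        ⨍ x in convexHull ℝ (Set.range p),
          dotProduct (crossProduct (cR n) (fun j => pd φ j x)) (f k x) ∂μH[((2 : ℕ) : ℝ)] := by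
    intro k
    have h2 := hκ (fun x => φ x • f k x) (hφ.smul (hf k))
    have h3 : ∀ (b : R3) x, ndot b (φ x • f k x) = dotProduct (φ x • cR b) (f k x) := fun b x => by
      simp [ndot, dotProduct, cR, Fin.sum_univ_three]; ring
    have h4 : ∀ x, ndot n (vcurl (fun x => φ x • f k x) x) =
        dotProduct (φ x • cR n) (vcurl (f k) x) +
          dotProduct (crossProduct (cR n) (fun j => pd φ j x)) (f k x) := fun x => by
      have h5 : ∀ i j, pd (fun y => (φ y • f k y) i) j x =
          pd φ j x * f k x i + φ x * pd (fun y => f k y i) j x := fun i j =>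
        pd_mul (hφ.differentiable one_ne_zero x)
          ((contDiff_pi.1 (hf k) i).differentiable one_ne_zero x) j
      simp only [vcurl, h5]
      simp [ndot, dotProduct, cR, Fin.sum_univ_three, cross_apply]; ring
    simp only [h3, h4] at h2
    rw [← h2, eq_sub_iff_add_eq]
    simp only [setAverage_eq]
    rw [← smul_add, ← integral_add]
    · exact integrableOn_dotProduct hp (hs n) (continuous_vcurl (hf k)).continuousOn
    · exact integrableOn_dotProduct hp hcross (hf k).continuous.continuousOn
  simp only [h1]
  have hedge := fun (i : Fin 3) (b : R3) => tendsto_setAverage_dotProduct (hinj i) (hsub i) (hs b)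
    (fun n => (hf n).continuous) hfe
  exact ((((hedge _ _).sub (hedge _ _)).add (hedge _ _)).const_mul _).sub
    (tendsto_setAverage_dotProduct hp hpK hcross (fun n => (hf n).continuous) hfe)

/-- Componentwise convolution of a vector field with a real kernel. -/
def mollify (ρ : R3 → ℝ) (u : R3 → C3) (x : R3) : C3 := fun i =>
  convolution ρ (fun y => u y i) (ContinuousLinearMap.lsmul ℝ ℝ) volume x

lemma mollify_apply (ρ : R3 → ℝ) (u : R3 → C3) (x : R3) (i : Fin 3) :
    mollify ρ u x i = ∫ y, (ρ (x - y) : ℂ) * u y i := by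
  rw [mollify, convolution_eq_swap]
  simp

lemma contDiff_mollify {ρ : R3 → ℝ} (hρ : ContDiff ℝ 1 ρ) (hρc : HasCompactSupport ρ)
    {u : R3 → C3} (hu : ∀ i, LocallyIntegrable fun y => u y i) : ContDiff ℝ 1 (mollify ρ u) :=
  contDiff_pi.2 fun i => hρc.contDiff_convolution_left _ (n := 1) hρ (hu i)

lemma hasCompactSupport_sub_left {E : Type*} [Zero E] {ρ : R3 → E} (hρc : HasCompactSupport ρ)
    (x : R3) : HasCompactSupport fun y => ρ (x - y) :=
  hρc.comp_homeomorph (Homeomorph.subLeft x)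

lemma pd_mollify {ρ : R3 → ℝ} (hρ : ContDiff ℝ 1 ρ) (hρc : HasCompactSupport ρ)
    {u : R3 → C3} (hu : ∀ i, LocallyIntegrable fun y => u y i) (i j : Fin 3) (x : R3) :
    pd (fun y => mollify ρ u y i) j x =
      ∫ y, (fderiv ℝ ρ (x - y) (Pi.single j 1) : ℂ) * u y i := by
  have h := hρc.hasFDerivAt_convolution_left (ContinuousLinearMap.lsmul ℝ ℝ) hρ (hu i) x
  have h2 : pd (fun y => mollify ρ u y i) j x = (convolution (fderiv ℝ ρ) (fun y => u y i)
      ((ContinuousLinearMap.lsmul ℝ ℝ).precompL R3) volume x) (Pi.single j 1) := by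
    rw [pd]
    exact congrArg (fun T => T (Pi.single j 1)) h.fderiv
  rw [h2, convolution_eq_swap, ContinuousLinearMap.integral_apply]
  · simp
  · exact (((hρc.fderiv ℝ).convolutionExists_left _ (hρ.continuous_fderiv one_ne_zero)
      (hu i)) x).integrable_swap

/-- A mollified field has a classical curl, the mollification of the weak one, away from the
boundary. -/
lemma vcurl_mollify {U : Set R3} (hU : MeasurableSet U) {v w : R3 → C3}
    (hv : ∀ i, LocallyIntegrable fun y => U.indicator v y i)
    (h : IsWeakCurlOn v w U) {ρ : R3 → ℝ} (hρ : ContDiff ℝ (⊤ : ℕ∞) ρ)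
    (hρc : HasCompactSupport ρ) {x : R3} (hx : ∀ y, x - y ∈ tsupport ρ → y ∈ U) :
    vcurl (mollify ρ (U.indicator v)) x = mollify ρ (U.indicator w) x := by
  have hρ1 : ContDiff ℝ 1 ρ := hρ.of_le (by exact_mod_cast le_top)
  have hψ : ContDiff ℝ (⊤ : ℕ∞) fun y => (ρ (x - y) : ℂ) :=
    Complex.ofRealCLM.contDiff.comp (hρ.comp (contDiff_const.sub contDiff_id))
  have hpd : ∀ j y, pd (fun y => (ρ (x - y) : ℂ)) j y =
      -(fderiv ℝ ρ (x - y) (Pi.single j 1) : ℂ) := by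
    intro j y
    have h1 : HasFDerivAt (fun y => x - y) (-ContinuousLinearMap.id ℝ R3) y := by
      exact (hasFDerivAt_id (𝕜 := ℝ) y).const_sub x
    have h2 := ((hρ1.differentiable one_ne_zero) (x - y)).hasFDerivAt.comp y h1
    have h3 : HasFDerivAt (fun y => (ρ (x - y) : ℂ)) (Complex.ofRealCLM.comp
        ((fderiv ℝ ρ (x - y)).comp (-ContinuousLinearMap.id ℝ R3))) y :=
      Complex.ofRealCLM.hasFDerivAt.comp y h2
    rw [pd, h3.fderiv]
    simp
  have hpd0 : ∀ j y, pd (fun _ => (0 : ℂ)) j y = 0 := fun j y => by simp [pd]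
  have key : ∀ k : Fin 3, ∫ y, dotC (U.indicator v y)
      (vcurl (fun y => Pi.single k (ρ (x - y) : ℂ)) y) = mollify ρ (U.indicator w) x k := by
    intro k
    have h1 := h (fun y => Pi.single k (ρ (x - y) : ℂ)) ?_ ?_ ?_
    · rw [← integral_indicator hU, ← integral_indicator hU] at h1
      rw [mollify_apply]
      refine (integral_congr_ae (Filter.Eventually.of_forall fun y => ?_)).trans
        (h1.trans (integral_congr_ae (Filter.Eventually.of_forall fun y => ?_)))
      · by_cases hy : y ∈ U <;> simp [hy, dotC]
      · by_cases hy : y ∈ U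
        · simp only [hy, Set.indicator_of_mem, dotC]
          rw [Finset.sum_eq_single k (fun i _ hik => by simp [hik]) (by simp)]
          simp [mul_comm]
        · simp [hy]
    · refine contDiff_pi.2 fun i => ?_
      by_cases hik : i = k
      · subst hik; simpa using hψ
      · simpa [hik] using contDiff_const
    · refine (hasCompactSupport_sub_left hρc x).mono fun y hy => ?_
      contrapose! hy
      simp only [Function.mem_support, ne_eq, not_not] at hy ⊢
      simp [hy]
    · intro y hy
      refine hx y ?_
      have h2 : tsupport (fun y => (Pi.single k (ρ (x - y) : ℂ) : C3)) ⊆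
          (fun y => x - y) ⁻¹' tsupport ρ := by
        refine closure_minimal (fun y hy => subset_tsupport _ ?_)
          ((isClosed_tsupport ρ).preimage (continuous_const.sub continuous_id))
        contrapose! hy
        simp only [Function.mem_support, ne_eq, not_not] at hy ⊢
        simp [hy]
      exact h2 hy
  have hint : ∀ i j : Fin 3, Integrable fun y =>
      (fderiv ℝ ρ (x - y) (Pi.single j 1) : ℂ) * U.indicator v y i := by
    intro i j
    have h1 : HasCompactSupport fun y => fderiv ℝ ρ y (Pi.single j 1) :=
      (hρc.fderiv ℝ).comp_left (g := fun T : R3 →L[ℝ] ℝ => T (Pi.single j 1)) (by simp)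
    have h2 : Continuous fun y => fderiv ℝ ρ y (Pi.single j 1) :=
      (hρ1.continuous_fderiv one_ne_zero).clm_apply continuous_const
    have h3 := (hv i).integrable_smul_left_of_hasCompactSupport
      (g := fun y => fderiv ℝ ρ (x - y) (Pi.single j 1))
      (h2.comp (continuous_const.sub continuous_id)) (hasCompactSupport_sub_left h1 x)
    simpa using h3
  have hdiff : ∀ i j i' j' : Fin 3,
      pd (fun y => mollify ρ (U.indicator v) y i) j x -
        pd (fun y => mollify ρ (U.indicator v) y i') j' x =
      ∫ y, ((fderiv ℝ ρ (x - y) (Pi.single j 1) : ℂ) * U.indicator v y i -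
        (fderiv ℝ ρ (x - y) (Pi.single j' 1) : ℂ) * U.indicator v y i') := fun i j i' j' => by
    rw [pd_mollify hρ1 hρc hv, pd_mollify hρ1 hρc hv, integral_sub (hint _ _) (hint _ _)]
  ext k
  rw [← key k]
  fin_cases k
  all_goals
    simp only [vcurl, hdiff, Fin.zero_eta, Fin.mk_one, Fin.reduceFinMk, Matrix.cons_val_zero,
      Matrix.cons_val_one, Matrix.cons_val]
    refine integral_congr_ae (Filter.Eventually.of_forall fun y => ?_)
    simp [dotC, Fin.sum_univ_three, hpd, hpd0]
    try ring

lemma locallyIntegrable_indicator {K U : Set R3} (hK : IsCompact K) (hUK : U ⊆ K)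
    (hU : MeasurableSet U) {v : R3 → C3} (hv : ContinuousOn v K) (i : Fin 3) :
    LocallyIntegrable fun y => U.indicator v y i := by
  have h : (fun y => U.indicator v y i) = U.indicator fun y => v y i := by
    ext y
    by_cases hy : y ∈ U <;> simp [hy]
  rw [h]
  exact ((integrable_indicator_iff hU).2
    (((continuousOn_pi.1 hv i).integrableOn_compact hK).mono_set hUK)).locallyIntegrable

/-- Mollifying along a homothety that contracts a convex body towards an interior point
converges uniformly. -/
lemma tendstoUniformlyOn_mollify {K : Set R3} (hK : IsCompact K) {v : R3 → C3}
    (hv : ContinuousOn v K) {ρ : ℕ → ContDiffBump (0 : R3)} {z : ℕ → R3 → R3}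
    (hz : ∀ n, ∀ x ∈ K, Metric.ball (z n x) (ρ n).rOut ⊆ interior K)
    (hρ : Filter.Tendsto (fun n => (ρ n).rOut) Filter.atTop (nhds 0))
    (hzx : TendstoUniformlyOn z id Filter.atTop K) :
    TendstoUniformlyOn (fun n x => mollify ((ρ n).normed volume) ((interior K).indicator v) (z n x))
      v Filter.atTop K := by
  have hli := locallyIntegrable_indicator hK interior_subset isOpen_interior.measurableSet hv
  rw [Metric.tendstoUniformlyOn_iff]
  intro ε hε
  obtain ⟨δ, hδ, h⟩ := Metric.uniformContinuousOn_iff.1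
    (hK.uniformContinuousOn_of_continuous hv) (ε / 2) (half_pos hε)
  filter_upwards [Metric.tendstoUniformlyOn_iff.1 hzx δ hδ, hρ.eventually_lt_const hδ]
    with n hn hn' x hx
  have hz' := hz n x hx
  have hzU : z n x ∈ interior K := hz' (Metric.mem_ball_self (ρ n).rOut_pos)
  have h1 : dist (v x) (v (z n x)) < ε / 2 := h _ hx _ (interior_subset hzU) (hn x hx)
  have h2 : dist (mollify ((ρ n).normed volume) ((interior K).indicator v) (z n x)) (v (z n x)) ≤
      ε / 2 := by
    refine (dist_pi_le_iff (half_pos hε).le).2 fun i => ?_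
    have h3 : v (z n x) i = (interior K).indicator v (z n x) i := by simp [hzU]
    rw [h3]
    refine ContDiffBump.dist_normed_convolution_le (g := fun y => (interior K).indicator v y i)
      (hli i).aestronglyMeasurable fun y hy => ?_
    have hyU := hz' hy
    simp only [hyU, hzU, Set.indicator_of_mem]
    refine (dist_le_pi_dist _ _ i).trans (h _ (interior_subset hyU) _ (interior_subset hzU) ?_).le
    exact (Metric.mem_ball.1 hy).trans hn'
  have h4 := dist_triangle_right (v x)
    (mollify ((ρ n).normed volume) ((interior K).indicator v) (z n x)) (v (z n x))
  linarith

lemma vcurl_comp_homothety {g : R3 → C3} (hg : ContDiff ℝ 1 g) (t : ℝ) (b x : R3) :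
    vcurl (fun x => g (t • x + b)) x = (t : ℂ) • vcurl g (t • x + b) := by
  have h : ∀ i j, pd (fun x => g (t • x + b) i) j x = t * pd (fun y => g y i) j (t • x + b) := by
    intro i j
    have h1 : HasFDerivAt (fun x => t • x + b) (t • ContinuousLinearMap.id ℝ R3) x :=
      ((hasFDerivAt_id x).const_smul t).add_const b
    have h2 := (((contDiff_pi.1 hg i).differentiable one_ne_zero)
      (t • x + b)).hasFDerivAt.comp x h1
    rw [pd, show fderiv ℝ (fun x => g (t • x + b) i) x = _ from h2.fderiv]
    simp [pd]
  ext i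
  fin_cases i <;> simp [vcurl, h, mul_sub]

/-- A continuous field on a convex body with a continuous weak curl is a uniform limit of `C¹`
fields along with its curl. -/
lemma curlApprox_of_isWeakCurlOn {K : Set R3} (hK : IsCompact K) (hKc : Convex ℝ K)
    (hKi : (interior K).Nonempty) {v w : R3 → C3} (hv : ContinuousOn v K) (hw : ContinuousOn w K)
    (h : IsWeakCurlOn v w (interior K)) : CurlApprox K v w := by
  obtain ⟨c, hc⟩ := hKi
  obtain ⟨r, hr, hrK⟩ := Metric.isOpen_iff.1 isOpen_interior c hc
  obtain ⟨D, hD⟩ := hK.isBounded.exists_norm_le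
  set s : ℕ → ℝ := fun n => 1 / ((n : ℝ) + 1 + 1) with hs
  have hs0 : ∀ n, 0 < s n := fun n => by positivity
  have hs1 : ∀ n, s n < 1 := fun n => by
    rw [hs]
    simp only
    rw [div_lt_one (by positivity)]
    have := n.cast_nonneg (α := ℝ)
    linarith
  have hst : Filter.Tendsto s Filter.atTop (nhds 0) := by
    have := (Filter.tendsto_add_atTop_iff_nat 1).2 (tendsto_one_div_add_atTop_nhds_zero_nat (𝕜 := ℝ))
    simpa [hs] using this
  set ρ : ℕ → ContDiffBump (0 : R3) := fun n =>
    ⟨s n * r / 4, s n * r / 2, by have := hs0 n; positivity, by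
      have := mul_pos (hs0 n) hr; linarith⟩ with hρ
  set z : ℕ → R3 → R3 := fun n x => (1 - s n) • x + s n • c with hz
  have hball : ∀ n, ∀ x ∈ K, Metric.ball (z n x) (s n * r) ⊆ interior K := by
    intro n x hx
    refine interior_maximal (fun y hy => ?_) Metric.isOpen_ball
    have h1 : c + (s n)⁻¹ • (y - z n x) ∈ K := by
      refine interior_subset (hrK ?_)
      rw [Metric.mem_ball, dist_eq_norm, add_sub_cancel_left, norm_smul, norm_inv,
        Real.norm_of_nonneg (hs0 n).le, inv_mul_lt_iff₀ (hs0 n), ← dist_eq_norm]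
      exact hy
    have h2 := hKc hx h1 (sub_nonneg.2 (hs1 n).le) (hs0 n).le (by ring)
    rwa [smul_add, smul_inv_smul₀ (hs0 n).ne', ← add_assoc, add_sub_cancel] at h2
  have hρout : ∀ n, (ρ n).rOut = s n * r / 2 := fun n => rfl
  have hz1 : ∀ n, ∀ x ∈ K, Metric.ball (z n x) (ρ n).rOut ⊆ interior K := fun n x hx =>
    (Metric.ball_subset_ball (by rw [hρout]; have := mul_pos (hs0 n) hr; linarith)).trans
      (hball n x hx)
  have hρ0 : Filter.Tendsto (fun n => (ρ n).rOut) Filter.atTop (nhds 0) := by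
    simp only [hρout]
    simpa using (hst.mul_const r).div_const 2
  have hzx : TendstoUniformlyOn z id Filter.atTop K := by
    rw [Metric.tendstoUniformlyOn_iff]
    intro ε hε
    have h1 : Filter.Tendsto (fun n => s n * (D + ‖c‖)) Filter.atTop (nhds 0) := by
      simpa using hst.mul_const (D + ‖c‖)
    filter_upwards [h1.eventually_lt_const hε] with n hn x hx
    refine lt_of_le_of_lt ?_ hn
    have h2 : x - z n x = s n • (x - c) := by simp only [hz]; module
    rw [id, dist_eq_norm, h2, norm_smul, Real.norm_of_nonneg (hs0 n).le]
    exact mul_le_mul_of_nonneg_left ((norm_sub_le _ _).trans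
      (add_le_add_left (hD x hx) _)) (hs0 n).le
  have hmeas : MeasurableSet (interior K) := isOpen_interior.measurableSet
  have hli := locallyIntegrable_indicator hK interior_subset hmeas hv
  have hm : ∀ n, ContDiff ℝ 1 (mollify ((ρ n).normed volume) ((interior K).indicator v)) :=
    fun n => contDiff_mollify (ρ n).contDiff_normed (ρ n).hasCompactSupport_normed hli
  refine ⟨fun n x => mollify ((ρ n).normed volume) ((interior K).indicator v) (z n x),
    fun n => (hm n).comp ((contDiff_id.const_smul _).add contDiff_const),
    tendstoUniformlyOn_mollify hK hv hz1 hρ0 hzx, ?_⟩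
  obtain ⟨M, hM⟩ := hK.exists_bound_of_continuousOn hw
  have hlim := tendstoUniformlyOn_mollify hK hw hz1 hρ0 hzx
  rw [Metric.tendstoUniformlyOn_iff] at hlim ⊢
  intro ε hε
  have h1 : Filter.Tendsto (fun n => s n * M) Filter.atTop (nhds 0) := by
    simpa using hst.mul_const M
  filter_upwards [hlim (ε / 2) (half_pos hε), h1.eventually_lt_const (half_pos hε)]
    with n hn hn' x hx
  rw [vcurl_comp_homothety (hm n)]
  change dist (w x) (((1 - s n : ℝ) : ℂ) • vcurl _ (z n x)) < ε
  rw [vcurl_mollify hmeas hli h (ρ n).contDiff_normed (ρ n).hasCompactSupport_normed]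
  · set W := mollify ((ρ n).normed volume) ((interior K).indicator w) (z n x) with hW
    have h2 : w x - ((1 - s n : ℝ) : ℂ) • W =
        ((1 - s n : ℝ) : ℂ) • (w x - W) + ((s n : ℝ) : ℂ) • w x := by
      push_cast
      module
    have h3 := hn x hx
    rw [dist_eq_norm] at h3 ⊢
    rw [h2]
    have h4 : ‖((1 - s n : ℝ) : ℂ) • (w x - W)‖ ≤ ‖w x - W‖ := by
      rw [norm_smul, Complex.norm_real, Real.norm_of_nonneg (sub_nonneg.2 (hs1 n).le)]
      exact mul_le_of_le_one_left (norm_nonneg _) (by linarith [hs0 n])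
    have h5 : ‖((s n : ℝ) : ℂ) • w x‖ ≤ s n * M := by
      rw [norm_smul, Complex.norm_real, Real.norm_of_nonneg (hs0 n).le]
      exact mul_le_mul_of_nonneg_left (hM x hx) (hs0 n).le
    linarith [norm_add_le (((1 - s n : ℝ) : ℂ) • (w x - W)) (((s n : ℝ) : ℂ) • w x)]
  · intro y hy
    rw [ContDiffBump.tsupport_normed_eq, mem_closedBall_zero_iff, hρout] at hy
    refine hball n x hx ?_
    rw [Metric.mem_ball, dist_comm, dist_eq_norm]
    have := mul_pos (hs0 n) hr
    linarith

/-- Evaluation of complex polynomials at real points. -/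
def evalReal : MvPolynomial (Fin 3) ℂ →ₐ[ℂ] (R3 → ℂ) :=
  AlgHom.pi fun x => MvPolynomial.aeval (cR x)

lemma evalReal_apply (p : MvPolynomial (Fin 3) ℂ) (x : R3) :
    evalReal p x = MvPolynomial.eval (fun j => (x j : ℂ)) p := by
  simp only [evalReal, AlgHom.pi_apply]
  rfl

lemma evalReal_X (i : Fin 3) : evalReal (MvPolynomial.X i) = fun x => (x i : ℂ) := by
  ext x; simp [evalReal_apply]

/-- The complex polynomial functions of degree at most `n` on `ℝ³`; only `0` if `n < 0`. -/
def polyFun (n : ℤ) : Submodule ℂ (R3 → ℂ) :=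
  (MvPolynomial.restrictSupport ℂ {s : Fin 3 →₀ ℕ | (s.degree : ℤ) ≤ n}).map evalReal.toLinearMap

lemma mem_polyFun {n : ℤ} {f : R3 → ℂ} :
    f ∈ polyFun n ↔ ∃ p : MvPolynomial (Fin 3) ℂ,
      (∀ s, p.coeff s ≠ 0 → (s.degree : ℤ) ≤ n) ∧ evalReal p = f := by
  simp only [polyFun, Submodule.mem_map, MvPolynomial.mem_restrictSupport_iff]
  refine exists_congr fun p => and_congr_left fun _ => ?_
  simp [Set.subset_def]

lemma evalReal_mem_polyFun {n : ℤ} {p : MvPolynomial (Fin 3) ℂ}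
    (h : ∀ s, p.coeff s ≠ 0 → (s.degree : ℤ) ≤ n) : evalReal p ∈ polyFun n :=
  mem_polyFun.2 ⟨p, h, rfl⟩

lemma polyFun_mono {m n : ℤ} (h : m ≤ n) {f : R3 → ℂ} (hf : f ∈ polyFun m) : f ∈ polyFun n := by
  obtain ⟨p, hp, rfl⟩ := mem_polyFun.1 hf
  exact evalReal_mem_polyFun fun s hs => (hp s hs).trans h

lemma polyFun_eq_zero {n : ℤ} (hn : n < 0) {f : R3 → ℂ} (hf : f ∈ polyFun n) : f = 0 := by
  obtain ⟨p, hp, rfl⟩ := mem_polyFun.1 hf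
  have : p = 0 := by
    ext s
    by_contra hs
    have := hp s (by simpa using hs)
    omega
  simp [this]

lemma PolyDeg.mem_polyFun {n : ℤ} {f : R3 → ℂ} (hf : PolyDeg n f) : f ∈ polyFun n := by
  obtain ⟨p, hp, h⟩ := hf
  refine _root_.mem_polyFun.2 ⟨p, fun s hs => le_trans ?_ hp, ?_⟩
  · have := MvPolynomial.le_totalDegree (MvPolynomial.mem_support_iff.2 hs)
    rw [Finsupp.degree_eq_sum]
    rw [Finsupp.sum_fintype _ _ (fun _ => rfl)] at this
    exact_mod_cast this
  · ext x
    rw [h, evalReal_apply]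

lemma polyDeg_of_mem_polyFun {n : ℤ} (hn : 0 ≤ n) {f : R3 → ℂ} (hf : f ∈ polyFun n) :
    PolyDeg n f := by
  obtain ⟨p, hp, rfl⟩ := mem_polyFun.1 hf
  refine ⟨p, ?_, evalReal_apply p⟩
  lift n to ℕ using hn
  have : p.totalDegree ≤ n := by
    refine Finset.sup_le fun s hs => ?_
    have := hp s (MvPolynomial.mem_support_iff.1 hs)
    rw [Finsupp.degree_eq_sum] at this
    rw [Finsupp.sum_fintype _ _ (fun _ => rfl)]
    exact_mod_cast this
  exact_mod_cast this

lemma mul_mem_polyFun {m n : ℤ} {f g : R3 → ℂ} (hf : f ∈ polyFun m) (hg : g ∈ polyFun n) :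
    (fun x => f x * g x) ∈ polyFun (m + n) := by
  obtain ⟨p, hp, rfl⟩ := mem_polyFun.1 hf
  obtain ⟨q, hq, rfl⟩ := mem_polyFun.1 hg
  refine mem_polyFun.2 ⟨p * q, fun s hs => ?_, by rw [map_mul]; rfl⟩
  rw [MvPolynomial.coeff_mul] at hs
  obtain ⟨⟨a, b⟩, hab, h⟩ := Finset.exists_ne_zero_of_sum_ne_zero hs
  have h1 := hp a (left_ne_zero_of_mul h)
  have h2 := hq b (right_ne_zero_of_mul h)
  rw [← Finset.HasAntidiagonal.mem_antidiagonal.1 hab, map_add]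
  push_cast
  omega

lemma const_mem_polyFun (c : ℂ) : (fun _ => c) ∈ polyFun 0 := by
  refine mem_polyFun.2 ⟨MvPolynomial.C c, fun s hs => ?_, by ext x; simp [evalReal_apply]⟩
  rw [MvPolynomial.coeff_C] at hs
  have : (0 : Fin 3 →₀ ℕ) = s := by
    by_contra h
    simp [h] at hs
  simp [← this]

lemma coord_mem_polyFun (i : Fin 3) : (fun x : R3 => (x i : ℂ)) ∈ polyFun 1 := by
  refine mem_polyFun.2 ⟨MvPolynomial.X i, fun s hs => ?_, evalReal_X i⟩
  rw [MvPolynomial.coeff_X] at hs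
  have : Finsupp.single i 1 = s := by
    by_contra h
    simp [h] at hs
  simp [← this]

lemma pow_mem_polyFun {f : R3 → ℂ} (hf : f ∈ polyFun 1) (n : ℕ) :
    (fun x => f x ^ n) ∈ polyFun n := by
  induction n with
  | zero => simpa using const_mem_polyFun 1
  | succ n ih => simpa [pow_succ] using mul_mem_polyFun ih hf

lemma prod_mem_polyFun {T : R3 → R3} (hT : ∀ i, (fun y => (T y i : ℂ)) ∈ polyFun 1)
    (s : Fin 3 →₀ ℕ) : (fun y => ∏ i, (T y i : ℂ) ^ s i) ∈ polyFun s.degree := by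
  rw [Finsupp.degree_eq_sum]
  simp only [Fin.prod_univ_three, Fin.sum_univ_three]
  push_cast
  exact mul_mem_polyFun (mul_mem_polyFun (pow_mem_polyFun (hT 0) _) (pow_mem_polyFun (hT 1) _))
    (pow_mem_polyFun (hT 2) _)

lemma comp_mem_polyFun {n : ℤ} {f : R3 → ℂ} (hf : f ∈ polyFun n) {T : R3 → R3}
    (hT : ∀ i, (fun y => (T y i : ℂ)) ∈ polyFun 1) : (fun y => f (T y)) ∈ polyFun n := by
  obtain ⟨p, hp, rfl⟩ := mem_polyFun.1 hf
  have h : (fun y => evalReal p (T y)) =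
      ∑ s ∈ p.support, p.coeff s • fun y => ∏ i, (T y i : ℂ) ^ s i := by
    ext y
    rw [evalReal_apply, MvPolynomial.eval_eq']
    simp
  rw [h]
  exact Submodule.sum_mem _ fun s hs => Submodule.smul_mem _ _
    (polyFun_mono (hp s (MvPolynomial.mem_support_iff.1 hs)) (prod_mem_polyFun hT s))

lemma conj_mem_polyFun {n : ℤ} {f : R3 → ℂ} (hf : f ∈ polyFun n) :
    (fun x => (starRingEnd ℂ) (f x)) ∈ polyFun n := by
  obtain ⟨p, hp, rfl⟩ := mem_polyFun.1 hf
  refine mem_polyFun.2 ⟨p.map (starRingEnd ℂ), fun s hs => hp s fun h => hs ?_, ?_⟩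
  · simp [MvPolynomial.coeff_map, h]
  · ext x
    rw [evalReal_apply, evalReal_apply, MvPolynomial.eval_map, ← MvPolynomial.eval₂_id,
      ← MvPolynomial.coe_eval₂Hom, ← MvPolynomial.coe_eval₂Hom, MvPolynomial.map_eval₂Hom]
    simp

lemma hasFDerivAt_evalReal (p : MvPolynomial (Fin 3) ℂ) (x : R3) :
    HasFDerivAt (evalReal p) (∑ j, (evalReal (MvPolynomial.pderiv j p) x) •
      Complex.ofRealCLM.comp (ContinuousLinearMap.proj (R := ℝ) j : R3 →L[ℝ] ℝ)) x := by
  induction p using MvPolynomial.induction_on with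
  | C a =>
    have : evalReal (MvPolynomial.C a) = fun _ => a := by ext x; simp [evalReal_apply]
    rw [this]
    exact (hasFDerivAt_const (𝕜 := ℝ) a x).congr_fderiv (by ext v; simp [Fin.sum_univ_three])
  | add p q hp hq =>
    rw [map_add]
    refine (hp.add hq).congr_fderiv ?_
    ext v
    simp [Fin.sum_univ_three]
    ring
  | mul_X p i hp =>
    have hX : HasFDerivAt (evalReal (MvPolynomial.X i)) (Complex.ofRealCLM.comp
        (ContinuousLinearMap.proj (R := ℝ) i : R3 →L[ℝ] ℝ)) x := by
      rw [evalReal_X]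
      exact (Complex.ofRealCLM.comp (ContinuousLinearMap.proj (R := ℝ) i : R3 →L[ℝ] ℝ)).hasFDerivAt
    rw [map_mul]
    refine (hp.mul hX).congr_fderiv ?_
    ext v
    fin_cases i <;> simp [Fin.sum_univ_three, Pi.single_apply] <;> ring

lemma contDiff_evalReal (p : MvPolynomial (Fin 3) ℂ) : ContDiff ℝ 1 (evalReal p) := by
  have h : evalReal p = fun x => ∑ s ∈ p.support, p.coeff s * ∏ i, (x i : ℂ) ^ s i := by
    ext x
    rw [evalReal_apply, MvPolynomial.eval_eq']
  have hc : ∀ i, ContDiff ℝ 1 fun x : R3 => (x i : ℂ) := fun i =>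
    Complex.ofRealCLM.contDiff.comp (contDiff_apply ℝ ℝ i)
  rw [h]
  fun_prop

lemma contDiff_of_mem_polyFun {n : ℤ} {f : R3 → ℂ} (hf : f ∈ polyFun n) : ContDiff ℝ 1 f := by
  obtain ⟨p, -, rfl⟩ := mem_polyFun.1 hf
  exact contDiff_evalReal p

lemma pd_evalReal (p : MvPolynomial (Fin 3) ℂ) (j : Fin 3) :
    pd (evalReal p) j = evalReal (MvPolynomial.pderiv j p) := by
  ext x
  rw [pd, (hasFDerivAt_evalReal p x).fderiv]
  simp [Pi.single_apply, apply_ite Complex.ofReal]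

lemma pd_mem_polyFun {n : ℤ} {f : R3 → ℂ} (hf : f ∈ polyFun n) (j : Fin 3) :
    pd f j ∈ polyFun (n - 1) := by
  obtain ⟨p, hp, rfl⟩ := mem_polyFun.1 hf
  rw [pd_evalReal]
  refine evalReal_mem_polyFun fun s hs => ?_
  rw [MvPolynomial.coeff_pderiv] at hs
  have := hp _ (left_ne_zero_of_mul hs)
  rw [map_add, Finsupp.degree_single] at this
  push_cast at this
  omega

/-- A polynomial vanishing on a real box is zero. -/
lemma eq_zero_of_evalReal_eq_zero {p : MvPolynomial (Fin 3) ℂ} {s : Fin 3 → Set ℝ}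
    (hs : ∀ i, (s i).Infinite) (h : ∀ x : R3, (∀ i, x i ∈ s i) → evalReal p x = 0) : p = 0 := by
  refine MvPolynomial.funext_set (fun i => Complex.ofReal '' s i)
    (fun i => (hs i).image Complex.ofReal_injective.injOn) fun z hz => ?_
  choose x hx hxz using fun i => hz i (Set.mem_univ i)
  have := h x hx
  rw [evalReal_apply] at this
  simp only [hxz] at this
  simpa using this

lemma eq_zero_of_evalReal_eq_zero' {p : MvPolynomial (Fin 3) ℂ} (h : evalReal p = 0) : p = 0 :=
  eq_zero_of_evalReal_eq_zero (s := fun _ => Set.univ) (fun _ => Set.infinite_univ)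
    fun x _ => by rw [h]; rfl

/-- A homogeneous polynomial function that is also of lower degree vanishes. -/
lemma PolyHom.eq_zero_of_smul_mem {n : ℤ} {φ : R3 → ℂ} (hφ : PolyHom n φ) {c : ℂ} (hc : c ≠ 0)
    (h : c • φ ∈ polyFun (n - 1)) : φ = 0 := by
  obtain ⟨d, rfl, p, hp, hφp⟩ := hφ
  obtain rfl : φ = evalReal p := by
    ext x; rw [hφp, evalReal_apply]
  obtain ⟨q, hq, hqp⟩ := mem_polyFun.1 h
  have h1 : q = c • p := by
    rw [← sub_eq_zero]
    exact eq_zero_of_evalReal_eq_zero' (by rw [map_sub, map_smul, hqp, sub_self])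
  have h2 : p = 0 := by
    ext s
    by_contra hs
    rw [MvPolynomial.coeff_zero] at hs
    have h3 := hq s (by rw [h1, MvPolynomial.coeff_smul]; exact smul_ne_zero hc hs)
    have h4 : s.degree = d := by
      have := hp hs
      rw [Finsupp.degree_eq_weight_one]
      exact this
    omega
  rw [h2, map_zero]

lemma PolyHom.mem_polyFun {n : ℤ} {φ : R3 → ℂ} (hφ : PolyHom n φ) : φ ∈ polyFun n := by
  obtain ⟨d, rfl, p, hp, hφp⟩ := hφ
  refine _root_.mem_polyFun.2 ⟨p, fun s hs => ?_, by ext x; rw [hφp, evalReal_apply]⟩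
  have h4 : s.degree = d := by
    have := hp hs
    rw [Finsupp.degree_eq_weight_one]
    exact this
  omega

/-- Euler's identity. -/
lemma PolyHom.sum_coord_mul_pd {n : ℤ} {φ : R3 → ℂ} (hφ : PolyHom n φ) (x : R3) :
    ∑ i, (x i : ℂ) * pd φ i x = n * φ x := by
  obtain ⟨d, rfl, p, hp, hφp⟩ := hφ
  obtain rfl : φ = evalReal p := by
    ext x; rw [hφp, evalReal_apply]
  have h := congrArg (fun q => evalReal q x) hp.sum_X_mul_pderiv
  simpa [evalReal_X, pd_evalReal] using h

/-- A polynomial function vanishing on a piece of the plane `y m = 0` is divisible by `y m`. -/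
lemma exists_eq_coord_mul {n : ℤ} {f : R3 → ℂ} (hf : f ∈ polyFun n) (m : Fin 3)
    {t : Set ℝ} (ht : t.Infinite) (h : ∀ y : R3, y m = 0 → (∀ i, i ≠ m → y i ∈ t) → f y = 0) :
    ∃ ψ ∈ polyFun (n - 1), ∀ y, f y = (y m : ℂ) * ψ y := by
  obtain ⟨p, hp, rfl⟩ := mem_polyFun.1 hf
  set r := p.modMonomial (Finsupp.single m 1) with hr
  have hdiv : MvPolynomial.X m * p.divMonomial (Finsupp.single m 1) + r = p :=
    MvPolynomial.divMonomial_add_modMonomial_single p m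
  have hdiv' : ∀ y, (y m : ℂ) * evalReal (p.divMonomial (Finsupp.single m 1)) y + evalReal r y =
      evalReal p y := fun y => by
    conv_rhs => rw [← hdiv]
    simp [evalReal_X]
  have hr0 : ∀ y : R3, evalReal r y = evalReal r (Function.update y m 0) := fun y => by
    simp only [evalReal_apply, MvPolynomial.eval_eq']
    refine Finset.sum_congr rfl fun s hs => congrArg _ (Finset.prod_congr rfl fun i _ => ?_)
    by_cases him : i = m
    · subst him
      have : s i = 0 := by
        by_contra h0
        refine MvPolynomial.mem_support_iff.1 hs (MvPolynomial.coeff_modMonomial_of_le p ?_)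
        rw [Finsupp.single_le_iff]
        omega
      simp [this]
    · simp [him]
  have hr1 : r = 0 := by
    refine eq_zero_of_evalReal_eq_zero (s := fun _ => t) (fun _ => ht) fun y hy => ?_
    have h1 := hdiv' (Function.update y m 0)
    rw [h _ (by simp) (fun i hi => by simpa [hi] using hy i)] at h1
    rw [hr0]
    simpa using h1
  refine ⟨_, evalReal_mem_polyFun (p := p.divMonomial (Finsupp.single m 1)) fun s hs => ?_,
    fun y => ?_⟩
  · rw [MvPolynomial.coeff_divMonomial] at hs
    have := hp _ hs
    rw [map_add, Finsupp.degree_single] at this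
    push_cast at this
    omega
  · have := hdiv' y
    rw [hr1] at this
    simpa using this.symm

lemma dotProduct_mem_polyFun {m n : ℤ} {a b : R3 → C3} (ha : ∀ i, (fun x => a x i) ∈ polyFun m)
    (hb : ∀ i, (fun x => b x i) ∈ polyFun n) :
    (fun x => dotProduct (a x) (b x)) ∈ polyFun (m + n) := by
  simp only [dotProduct, Fin.sum_univ_three]
  exact Submodule.add_mem _ (Submodule.add_mem _ (mul_mem_polyFun (ha 0) (hb 0))
    (mul_mem_polyFun (ha 1) (hb 1))) (mul_mem_polyFun (ha 2) (hb 2))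

lemma sub_mem_polyFun {n : ℤ} {f g : R3 → ℂ} (hf : f ∈ polyFun n) (hg : g ∈ polyFun n) :
    (fun x => f x - g x) ∈ polyFun n := Submodule.sub_mem _ hf hg

lemma add_mem_polyFun {n : ℤ} {f g : R3 → ℂ} (hf : f ∈ polyFun n) (hg : g ∈ polyFun n) :
    (fun x => f x + g x) ∈ polyFun n := Submodule.add_mem _ hf hg

lemma mul_const_mem_polyFun {n : ℤ} {f : R3 → ℂ} (hf : f ∈ polyFun n) (c : ℂ) :
    (fun x => f x * c) ∈ polyFun n := by
  simpa using mul_mem_polyFun hf (const_mem_polyFun c)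

lemma sum_mem_polyFun {n : ℤ} {f : Fin 3 → R3 → ℂ} (hf : ∀ i, f i ∈ polyFun n) :
    (fun x => ∑ i, f i x) ∈ polyFun n := by
  simp only [Fin.sum_univ_three]
  exact add_mem_polyFun (add_mem_polyFun (hf 0) (hf 1)) (hf 2)

lemma cross_mem_polyFun {m n : ℤ} {a b : R3 → C3} (ha : ∀ i, (fun x => a x i) ∈ polyFun m)
    (hb : ∀ i, (fun x => b x i) ∈ polyFun n) (i : Fin 3) :
    (fun x => crossProduct (a x) (b x) i) ∈ polyFun (m + n) := by
  simp only [cross_apply]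
  fin_cases i <;>
    exact sub_mem_polyFun (mul_mem_polyFun (ha _) (hb _)) (mul_mem_polyFun (ha _) (hb _))

lemma vcurl_mem_polyFun {n : ℤ} {q : R3 → C3} (hq : ∀ i, (fun x => q x i) ∈ polyFun n)
    (i : Fin 3) : (fun x => vcurl q x i) ∈ polyFun (n - 1) := by
  have h := fun i j => pd_mem_polyFun (hq i) j
  fin_cases i <;> exact sub_mem_polyFun (h _ _) (h _ _)

lemma contDiff_of_forall_mem_polyFun {n : ℤ} {q : R3 → C3}
    (hq : ∀ i, (fun x => q x i) ∈ polyFun n) : ContDiff ℝ 1 q :=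
  contDiff_pi.2 fun i => contDiff_of_mem_polyFun (hq i)

/-- A continuous nonnegative function with zero mean over the reference simplex vanishes on the
reference cube. -/
lemma eq_zero_of_setAverage_refSimplex_eq_zero {d : ℕ} {G : (Fin d → ℝ) → ℝ} (hG : Continuous G)
    (hG0 : ∀ y ∈ refSimplex d, 0 ≤ G y) (h : ⨍ y in refSimplex d, (G y : ℂ) = 0) :
    ∀ y ∈ refCube d, G y = 0 := by
  have hm : MeasurableSet (refSimplex d) := (isClosed_refSimplex d).measurableSet
  have h1 : ∫ y in refSimplex d, G y = 0 := by
    rw [setAverage_eq, smul_eq_zero, inv_eq_zero, measureReal_def,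
      ENNReal.toReal_eq_zero_iff] at h
    rcases h with h | h
    · rcases h with h | h
      · exact absurd h (volume_refSimplex_ne_zero d)
      · exact absurd h (volume_refSimplex_ne_top d)
    · exact Complex.ofReal_eq_zero.1 (integral_complex_ofReal.symm.trans h)
  rw [setIntegral_eq_zero_iff_of_nonneg_ae ((ae_restrict_iff' hm).2 (Filter.Eventually.of_forall
    hG0)) (hG.continuousOn.integrableOn_compact (isCompact_refSimplex d))] at h1
  have h2 : G =ᵐ[volume.restrict (refCube d)] 0 :=
    ae_restrict_of_ae_restrict_of_subset (refCube_subset_refSimplex d) h1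
  exact Measure.eqOn_open_of_ae_eq h2 (isOpen_refCube d) hG.continuousOn continuousOn_const

lemma infinite_Ioo_refCube (d : ℕ) : (Set.Ioo (0 : ℝ) (1 / ((d : ℝ) + 1))).Infinite :=
  Set.Ioo_infinite (by positivity)

lemma simplexParam_mem_polyFun (vt : Fin 4 → R3) (i : Fin 3) :
    (fun y => (simplexParam vt 0 y i : ℂ)) ∈ polyFun 1 := by
  have h : (fun y : R3 => (simplexParam vt 0 y i : ℂ)) = fun y =>
      (vt 0 i : ℂ) + ∑ l, (y l : ℂ) * ((vt l.succ - vt 0) i : ℂ) := by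
    ext y
    rw [simplexParam_apply]
    simp
  rw [h]
  exact add_mem_polyFun (polyFun_mono zero_le_one (const_mem_polyFun _))
    (sum_mem_polyFun fun l => mul_const_mem_polyFun (coord_mem_polyFun l) _)

/-- The barycentric coordinates with respect to the vertices other than the first. -/
def baryCoord (vt : Fin 4 → R3) (g : Fin 3 → R3) (x : R3) : R3 := fun m => dotR (g m) (x - vt 0)

lemma baryCoord_mem_polyFun (vt : Fin 4 → R3) (g : Fin 3 → R3) (m : Fin 3) :
    (fun x => (baryCoord vt g x m : ℂ)) ∈ polyFun 1 := by
  have h : (fun x => (baryCoord vt g x m : ℂ)) = fun x : R3 =>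
      ∑ i, ((x i : ℂ) - (vt 0 i : ℂ)) * (g m i : ℂ) := by
    ext x
    simp [baryCoord, dotR, mul_comm]
  rw [h]
  exact sum_mem_polyFun fun i => mul_const_mem_polyFun (sub_mem_polyFun (coord_mem_polyFun i)
    (polyFun_mono zero_le_one (const_mem_polyFun _))) _

lemma simplexParam_baryCoord {vt : Fin 4 → R3} {g : Fin 3 → R3}
    (h : ∀ i j, ∑ m, g m i * (vt m.succ - vt 0) j = if i = j then 1 else 0) (x : R3) :
    simplexParam vt 0 (baryCoord vt g x) = x := by
  rw [simplexParam_apply]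
  ext j
  have h1 : ∑ m, baryCoord vt g x m * (vt m.succ - vt 0) j = x j - vt 0 j := by
    simp only [baryCoord, dotR, Finset.sum_mul]
    rw [Finset.sum_comm]
    have h2 : ∀ i, ∑ m, g m i * (x - vt 0) i * (vt m.succ - vt 0) j =
        (x - vt 0) i * if i = j then 1 else 0 := fun i => by
      rw [← h i j, Finset.mul_sum]
      exact Finset.sum_congr rfl fun m _ => by ring
    simp only [h2]
    simp
  simp only [Pi.add_apply, Finset.sum_apply, Pi.smul_apply, smul_eq_mul, Fin.zero_succAbove]
  rw [h1]
  ring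

lemma baryCoord_simplexParam {vt : Fin 4 → R3} {g : Fin 3 → R3}
    (h : ∀ m l, dotR (g m) (vt l.succ - vt 0) = if m = l then 1 else 0) (y : R3) :
    baryCoord vt g (simplexParam vt 0 y) = y := by
  ext m
  simp only [baryCoord, simplexParam_apply, add_sub_cancel_left, Fin.zero_succAbove]
  have h1 : dotR (g m) (∑ l, y l • (vt l.succ - vt 0)) =
      ∑ l, y l * dotR (g m) (vt l.succ - vt 0) := by
    simp only [dotR, Finset.sum_apply, Pi.smul_apply, smul_eq_mul, Finset.mul_sum]
    rw [Finset.sum_comm]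
    exact Finset.sum_congr rfl fun _ _ => Finset.sum_congr rfl fun _ _ => by ring
  rw [h1]
  simp [h]

/-- A polynomial that is orthogonal to itself on a tetrahedron vanishes. -/
lemma eq_zero_of_setAverage_conj_mul_self {vt : Fin 4 → R3} (hvt : AffineIndependent ℝ vt)
    {g : Fin 3 → R3}
    (hg : ∀ i j, ∑ m, g m i * (vt m.succ - vt 0) j = if i = j then 1 else 0)
    {n : ℤ} {f : R3 → ℂ} (hf : f ∈ polyFun n)
    (h : ⨍ x in convexHull ℝ (Set.range vt), (starRingEnd ℂ) (f x) * f x = 0) : f = 0 := by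
  rw [← hausdorffMeasure_three_eq_volume, setAverage_convexHull_eq hvt 0] at h
  have hfT := comp_mem_polyFun hf (simplexParam_mem_polyFun vt)
  have hc := (contDiff_of_mem_polyFun hfT).continuous
  simp only [← Complex.normSq_eq_conj_mul_self] at h
  have h1 := eq_zero_of_setAverage_refSimplex_eq_zero (Complex.continuous_normSq.comp hc)
    (fun y _ => Complex.normSq_nonneg _) h
  obtain ⟨p, -, hp⟩ := mem_polyFun.1 hfT
  have h2 : p = 0 := eq_zero_of_evalReal_eq_zero (fun _ => infinite_Ioo_refCube 3) fun y hy => by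
    rw [hp]
    exact Complex.normSq_eq_zero.1 (h1 y fun i _ => hy i)
  ext x
  have h3 := congrFun hp (baryCoord vt g x)
  rw [h2, map_zero, simplexParam_baryCoord hg] at h3
  exact h3.symm

/-- A polynomial field on a tetrahedron whose volume moments and normal face moments vanish is
divergence free. -/
lemma sum_pd_eq_zero_of_moments {vt nrm : Fin 4 → R3} (hvt : AffineIndependent ℝ vt)
    (hn_orth : ∀ σ, ∀ i, i ≠ σ → ∀ j, j ≠ σ → dotR (nrm σ) (vt i - vt j) = 0)
    (hn_out : ∀ σ, ∀ i, i ≠ σ → dotR (nrm σ) (vt σ - vt i) < 0)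
    {n : ℤ} {p : R3 → C3} (hp : ∀ i, (fun x => p x i) ∈ polyFun (n + 1))
    (hvol : ∀ q : R3 → C3, (∀ i, (fun x => q x i) ∈ polyFun (n - 1)) →
      ⨍ x in convexHull ℝ (Set.range vt), dotProduct (q x) (p x) = 0)
    (hface : ∀ σ : Fin 4, ∀ q ∈ polyFun n,
      ⨍ x in convexHull ℝ (Set.range (vt ∘ σ.succAbove)),
        dotProduct (q x • cR (nrm σ)) (p x) ∂μH[((2 : ℕ) : ℝ)] = 0) :
    ∀ x, ∑ i, pd (fun y => p y i) i x = 0 := by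
  obtain ⟨g, c, -, -, -, hinv⟩ := exists_barycentric_gradients hn_orth hn_out
  obtain ⟨κ, hκ⟩ := exists_setAverage_divergence hvt hn_orth hn_out
  set δ : R3 → ℂ := fun x => ∑ i, pd (fun y => p y i) i x with hδ
  have hδn : δ ∈ polyFun n := sum_mem_polyFun fun i => by
    simpa using pd_mem_polyFun (hp i) i
  set q : R3 → ℂ := fun x => (starRingEnd ℂ) (δ x) with hq
  have hqn : q ∈ polyFun n := conj_mem_polyFun hδn
  have hqd := contDiff_of_mem_polyFun hqn
  have hpd := contDiff_of_forall_mem_polyFun hp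
  have hpq : ContDiff ℝ 1 fun x => q x • p x := hqd.smul hpd
  have h1 := hκ _ hpq
  have h2 : ∀ σ, ⨍ x in convexHull ℝ (Set.range (vt ∘ σ.succAbove)),
      ndot (nrm σ) (q x • p x) ∂μH[((2 : ℕ) : ℝ)] = 0 := fun σ => by
    rw [← hface σ q hqn]
    congr 1
    ext x
    change dotProduct (cR (nrm σ)) (q x • p x) = _
    rw [smul_dotProduct, dotProduct_smul]
  have h3 : ∀ x, ∑ i, pd (fun y => (q y • p y) i) i x =
      dotProduct (fun i => pd q i x) (p x) + q x * δ x := fun x => by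
    simp only [Pi.smul_apply, smul_eq_mul, dotProduct, hδ, Finset.mul_sum]
    rw [← Finset.sum_add_distrib]
    exact Finset.sum_congr rfl fun i _ => pd_mul (hqd.differentiable one_ne_zero x)
      ((contDiff_pi.1 hpd i).differentiable one_ne_zero x) i
  have hc := isCompact_convexHull_range vt
  have h4 : ⨍ x in convexHull ℝ (Set.range vt), q x * δ x = 0 := by
    simp only [h2, mul_zero, Finset.sum_const_zero, h3] at h1
    have h5 := hvol (fun x i => pd q i x) fun i => pd_mem_polyFun hqn i
    rw [setAverage_eq] at h1 h5 ⊢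
    rw [integral_add, smul_add, h5, zero_add] at h1
    · exact h1
    · exact (contDiff_of_mem_polyFun (dotProduct_mem_polyFun (a := fun x i => pd q i x)
        (fun i => pd_mem_polyFun hqn i) hp)).continuous.continuousOn.integrableOn_compact hc
    · exact (contDiff_of_mem_polyFun (mul_mem_polyFun hqn
        hδn)).continuous.continuousOn.integrableOn_compact hc
  have h5 := eq_zero_of_setAverage_conj_mul_self hvt hinv hδn h4
  exact fun x => congrFun h5 x

/-- A homogeneous polynomial is determined by the divergence of its product with the position
field, up to lower order terms. -/
lemma PolyHom.eq_zero_of_sum_pd_eq_zero {n : ℤ} {φ : R3 → ℂ} (hφ : PolyHom n φ) {g : R3 → C3}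
    (hg : ∀ i, (fun x => g x i) ∈ polyFun n)
    (h : ∀ x, ∑ i, pd (fun y => g y i + φ y * (y i : ℂ)) i x = 0) : φ = 0 := by
  have hn : 0 ≤ n := by
    obtain ⟨d, rfl, -⟩ := hφ
    positivity
  have hφd := contDiff_of_mem_polyFun hφ.mem_polyFun
  have hgd := contDiff_of_forall_mem_polyFun hg
  have h1 : ∀ x, ∑ i, pd (fun y => g y i + φ y * (y i : ℂ)) i x =
      ∑ i, pd (fun y => g y i) i x + ((n : ℂ) + 3) * φ x := fun x => by
    have hcoord : ∀ i, pd (fun y : R3 => (y i : ℂ)) i x = 1 := fun i => by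
      rw [← evalReal_X, pd_evalReal]
      simp
    have h2 : ∀ i, pd (fun y => g y i + φ y * (y i : ℂ)) i x =
        pd (fun y => g y i) i x + (pd φ i x * x i + φ x) := fun i => by
      have hc := contDiff_of_mem_polyFun (coord_mem_polyFun i)
      have h3 := pd_mul (hφd.differentiable one_ne_zero x) (hc.differentiable one_ne_zero x) i
      rw [hcoord, mul_one] at h3
      rw [← h3]
      exact DFunLike.congr_fun (fderiv_add ((contDiff_pi.1 hgd i).differentiable one_ne_zero x)
        ((hφd.mul hc).differentiable one_ne_zero x)) _
    simp only [h2, Finset.sum_add_distrib]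
    have h4 := hφ.sum_coord_mul_pd x
    simp only [mul_comm ((_ : ℝ) : ℂ)] at h4
    rw [h4]
    simp
    ring
  refine hφ.eq_zero_of_smul_mem (c := (n : ℂ) + 3) ?_ ?_
  · exact_mod_cast (by omega : n + 3 ≠ 0)
  · have h2 : ((n : ℂ) + 3) • φ = fun x => (∑ i, pd (fun y => g y i) i x) * (-1) := by
      ext x
      have h3 := h x
      rw [h1] at h3
      simp only [Pi.smul_apply, smul_eq_mul]
      linear_combination h3
    rw [h2]
    exact mul_const_mem_polyFun (sum_mem_polyFun fun i => pd_mem_polyFun (hg i) i) _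

/-- The normal component of a polynomial field with vanishing normal moments on a face is
divisible by the corresponding barycentric coordinate. -/
lemma exists_eq_mul_of_face_moments {vt : Fin 4 → R3} (hvt : AffineIndependent ℝ vt)
    {n : ℤ} {u : R3 → ℂ} (hu : u ∈ polyFun n) (m : Fin 3)
    (h : ⨍ x in convexHull ℝ (Set.range (vt ∘ m.succ.succAbove)),
        (starRingEnd ℂ) (u x) * u x ∂μH[((2 : ℕ) : ℝ)] = 0) :
    ∃ ψ ∈ polyFun (n - 1), ∀ y, u (simplexParam vt 0 y) = (y m : ℂ) * ψ y := by
  refine exists_eq_coord_mul (comp_mem_polyFun hu (simplexParam_mem_polyFun vt)) m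
    (infinite_Ioo_refCube 2) fun y hy0 hy => ?_
  have hp : AffineIndependent ℝ (vt ∘ m.succ.succAbove) :=
    hvt.comp_embedding m.succ.succAboveEmb
  rw [setAverage_convexHull_eq hp (m.predAbove 0)] at h
  simp only [← Complex.normSq_eq_conj_mul_self] at h
  have hT : Continuous (simplexParam (vt ∘ m.succ.succAbove) (m.predAbove 0)) := by
    have : simplexParam (vt ∘ m.succ.succAbove) (m.predAbove 0) = fun y => _ :=
      funext fun y => simplexParam_apply _ _ y
    rw [this]
    fun_prop
  have h1 := eq_zero_of_setAverage_refSimplex_eq_zero (Complex.continuous_normSq.comp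
    ((contDiff_of_mem_polyFun hu).continuous.comp hT))
    (fun y _ => Complex.normSq_nonneg _) h
  have h2 := simplexParam_insertNth_zero vt 0 m (fun l => y (m.succAbove l))
  rw [Fin.zero_succAbove] at h2
  have h3 : m.insertNth (α := fun _ => ℝ) 0 (fun l => y (m.succAbove l)) = y := by
    rw [← hy0]
    exact Fin.insertNth_self_removeNth m y
  rw [h3] at h2
  rw [h2]
  refine Complex.normSq_eq_zero.1 (h1 _ fun l _ => ?_)
  exact hy _ (Fin.succAbove_ne m l)

/-- Unisolvence of the degrees of freedom of the first-family space. -/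
lemma eq_zero_of_moments {vt nrm : Fin 4 → R3} (hvt : AffineIndependent ℝ vt)
    (hn_orth : ∀ σ, ∀ i, i ≠ σ → ∀ j, j ≠ σ → dotR (nrm σ) (vt i - vt j) = 0)
    (hn_out : ∀ σ, ∀ i, i ≠ σ → dotR (nrm σ) (vt σ - vt i) < 0)
    {n : ℤ} {p g : R3 → C3} {φ : R3 → ℂ} (hg : ∀ i, (fun x => g x i) ∈ polyFun n)
    (hφ : PolyHom n φ) (hp : ∀ x, p x = fun i => g x i + φ x * (x i : ℂ))
    (hvol : ∀ q : R3 → C3, (∀ i, (fun x => q x i) ∈ polyFun (n - 1)) →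
      ⨍ x in convexHull ℝ (Set.range vt), dotProduct (q x) (p x) = 0)
    (hface : ∀ σ : Fin 4, ∀ q ∈ polyFun n,
      ⨍ x in convexHull ℝ (Set.range (vt ∘ σ.succAbove)),
        dotProduct (q x • cR (nrm σ)) (p x) ∂μH[((2 : ℕ) : ℝ)] = 0) :
    p = 0 := by
  have hφ0 : φ = 0 := by
    refine hφ.eq_zero_of_sum_pd_eq_zero hg fun x => ?_
    have h := sum_pd_eq_zero_of_moments hvt hn_orth hn_out (p := p) (n := n)
      (fun i => by
        simp only [hp]
        exact add_mem_polyFun (polyFun_mono (by omega) (hg i))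
          (mul_mem_polyFun hφ.mem_polyFun (coord_mem_polyFun i))) hvol hface x
    simpa only [hp] using h
  have hpn : ∀ i, (fun x => p x i) ∈ polyFun n := fun i => by
    simpa [hp, hφ0] using hg i
  obtain ⟨ℓ, c, hℓ, -, hdual, hinv⟩ := exists_barycentric_gradients hn_orth hn_out
  have hu : ∀ m, (fun x => dotProduct (cR (ℓ m)) (p x)) ∈ polyFun n := fun m => by
    simpa using dotProduct_mem_polyFun (fun i => const_mem_polyFun (cR (ℓ m) i)) hpn
  have hψ : ∀ m, ∃ ψ ∈ polyFun (n - 1), ∀ y,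
      dotProduct (cR (ℓ m)) (p (simplexParam vt 0 y)) = (y m : ℂ) * ψ y := fun m => by
    refine exists_eq_mul_of_face_moments hvt (hu m) m ?_
    rw [← hface m.succ (fun x => (starRingEnd ℂ) (dotProduct (cR (ℓ m)) (p x)) * c m.succ)
      (mul_const_mem_polyFun (conj_mem_polyFun (hu m)) _)]
    congr 1
    ext x
    have h : cR (ℓ m) = (c m.succ : ℂ) • cR (nrm m.succ) := by
      ext i
      simp [hℓ, cR]
    rw [mul_smul, ← h, smul_dotProduct, smul_eq_mul]
  choose ψ hψn hψ using hψ
  have hq : ∀ i, (fun x => ∑ m, (starRingEnd ℂ) (ψ m (baryCoord vt ℓ x)) * (ℓ m i : ℂ)) ∈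
      polyFun (n - 1) := fun i => sum_mem_polyFun fun m => mul_const_mem_polyFun
    (conj_mem_polyFun (comp_mem_polyFun (hψn m) (baryCoord_mem_polyFun vt ℓ))) _
  have h1 := hvol (fun x i => ∑ m, (starRingEnd ℂ) (ψ m (baryCoord vt ℓ x)) * (ℓ m i : ℂ)) hq
  rw [← hausdorffMeasure_three_eq_volume, setAverage_convexHull_eq hvt 0] at h1
  have h2 : ∀ y, dotProduct (fun i => ∑ m, (starRingEnd ℂ)
      (ψ m (baryCoord vt ℓ (simplexParam vt 0 y))) * (ℓ m i : ℂ)) (p (simplexParam vt 0 y)) =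
      ((∑ m, y m * Complex.normSq (ψ m y) : ℝ) : ℂ) := fun y => by
    rw [baryCoord_simplexParam hdual]
    have h3 : ∀ m, (starRingEnd ℂ) (ψ m y) *
        dotProduct (cR (ℓ m)) (p (simplexParam vt 0 y)) =
          ((y m * Complex.normSq (ψ m y) : ℝ) : ℂ) := fun m => by
        rw [hψ, Complex.ofReal_mul, Complex.normSq_eq_conj_mul_self]
        ring
    rw [Complex.ofReal_sum]
    simp only [← h3, dotProduct, Finset.sum_mul, Finset.mul_sum, cR]
    rw [Finset.sum_comm]
    exact Finset.sum_congr rfl fun _ _ => Finset.sum_congr rfl fun _ _ => by ring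
  simp only [h2] at h1
  have hψc := fun m => (contDiff_of_mem_polyFun (hψn m)).continuous
  have h3 := eq_zero_of_setAverage_refSimplex_eq_zero (by
      have := Complex.continuous_normSq
      fun_prop)
    (fun y hy => Finset.sum_nonneg fun m _ => mul_nonneg (hy.1 m) (Complex.normSq_nonneg _)) h1
  have hψ0 : ∀ m y, ψ m y = 0 := fun m => by
    obtain ⟨r, -, hr⟩ := mem_polyFun.1 (hψn m)
    have hr0 : r = 0 := eq_zero_of_evalReal_eq_zero (fun _ => infinite_Ioo_refCube 3)
      fun y hy => by
        have h4 := (Finset.sum_eq_zero_iff_of_nonneg fun m _ =>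
          mul_nonneg (hy m).1.le (Complex.normSq_nonneg _)).1 (h3 y fun i _ => hy i) m
            (Finset.mem_univ m)
        rw [hr]
        exact Complex.normSq_eq_zero.1 ((mul_eq_zero.1 h4).resolve_left (hy m).1.ne')
    intro y
    rw [← hr, hr0, map_zero, Pi.zero_apply]
  have h4 : ∀ m x, dotProduct (cR (ℓ m)) (p x) = 0 := fun m x => by
    rw [← simplexParam_baryCoord hinv x, hψ, hψ0, mul_zero]
  ext x j
  have h5 : p x j = ∑ m, dotProduct (cR (ℓ m)) (p x) * ((vt m.succ - vt 0) j : ℂ) := by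
    simp only [dotProduct, cR, Finset.sum_mul]
    rw [Finset.sum_comm]
    have h6 : ∀ i, ∑ m, (ℓ m i : ℂ) * p x i * ((vt m.succ - vt 0) j : ℂ) =
        p x i * if i = j then 1 else 0 := fun i => by
      have h7 := congrArg Complex.ofReal (hinv i j)
      push_cast [apply_ite Complex.ofReal] at h7
      rw [← h7, Finset.mul_sum]
      exact Finset.sum_congr rfl fun m _ => by ring
    simp only [h6]
    simp
  rw [h5]
  simp [h4]

lemma VPolyDeg.dSpace {n : ℤ} {q : R3 → C3} (h : VPolyDeg (n - 1) q) : DSpace n q := by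
  refine ⟨q, 0, h, ?_, by simp⟩
  obtain ⟨p, hp, -⟩ := h 0
  lift n - 1 to ℕ using by omega with d hd
  exact ⟨d, rfl, 0, MvPolynomial.isHomogeneous_zero _ _ _, by simp⟩

lemma setAverage_mul_eq_zero_of_moments {S : Set R3} {μ : Measure R3} {A : R3 → ℂ} {n : ℤ}
    (h : ∀ q : R3 → ℂ, PolyDeg n q → ∫ x in S, A x * (starRingEnd ℂ) (q x) ∂μ = 0)
    {q : R3 → ℂ} (hq : q ∈ polyFun n) : ⨍ x in S, q x * A x ∂μ = 0 := by
  rcases lt_or_ge n 0 with hn | hn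
  · simp [polyFun_eq_zero hn hq]
  · have h1 := h _ (polyDeg_of_mem_polyFun hn (conj_mem_polyFun hq))
    simp only [Complex.conj_conj, mul_comm (A _)] at h1
    rw [setAverage_eq, h1, smul_zero]

lemma setAverage_dotProduct_eq_zero_of_moments {S : Set R3} {μ : Measure R3} {A : R3 → C3} {n : ℤ}
    (h : ∀ q : R3 → C3, VPolyDeg n q → ∫ x in S, dotC (A x) (q x) ∂μ = 0)
    {q : R3 → C3} (hq : ∀ i, (fun x => q x i) ∈ polyFun n) :
    ⨍ x in S, dotProduct (q x) (A x) ∂μ = 0 := by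
  rcases lt_or_ge n 0 with hn | hn
  · have h0 : ∀ x, q x = 0 := fun x => funext fun i => congrFun (polyFun_eq_zero hn (hq i)) x
    simp [h0]
  · have h1 := h (fun x i => (starRingEnd ℂ) (q x i))
      fun i => polyDeg_of_mem_polyFun hn (conj_mem_polyFun (hq i))
    simp only [dotC, Complex.conj_conj, mul_comm (A _ _)] at h1
    rw [setAverage_eq]
    exact (congrArg _ h1).trans (smul_zero _)

lemma dotProduct_tang {n : R3} {q : C3} (h : dotProduct q (cR n) = 0) (a : C3) :
    dotProduct q (tang n a) = dotProduct q a := by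
  have h1 : tang n a = a - ndot n a • cR n := rfl
  rw [h1, dotProduct_sub, dotProduct_smul, h, smul_zero, sub_zero]

lemma setAverage_segment_eq_zero_of_moments {a b : R3} (hab : a ≠ b) {A : R3 → C3} {n : ℤ}
    (h : ∀ q : R3 → ℂ, PolyDeg n q → ∫ x in segment ℝ a b,
      ndot ((Real.sqrt (dotR (b - a) (b - a)))⁻¹ • (b - a)) (A x) * (starRingEnd ℂ) (q x)
        ∂(μH[1]) = 0)
    {φ : R3 → ℂ} (hφ : φ ∈ polyFun n) :
    ⨍ x in segment ℝ a b, dotProduct (φ x • cR (b - a)) (A x) ∂μH[((1 : ℕ) : ℝ)] = 0 := by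
  set r := (Real.sqrt (dotR (b - a) (b - a)))⁻¹ with hr
  have hr0 : (r : ℂ) ≠ 0 := by
    have h1 : 0 < dotR (b - a) (b - a) :=
      lt_of_le_of_ne (Finset.sum_nonneg fun i _ => mul_self_nonneg _)
        fun h0 => hab (sub_eq_zero.1 (dotProduct_self_eq_zero.1 h0.symm)).symm
    exact_mod_cast inv_ne_zero (Real.sqrt_pos.2 h1).ne'
  have h1 := setAverage_mul_eq_zero_of_moments h (mul_const_mem_polyFun hφ (r : ℂ)⁻¹)
  rw [Nat.cast_one, ← h1]
  congr 1
  ext x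
  have h2 : ndot (r • (b - a)) (A x) = r * dotProduct (cR (b - a)) (A x) := by
    simp only [ndot, dotProduct, cR, Finset.mul_sum]
    exact Finset.sum_congr rfl fun i _ => by
      rw [Pi.smul_apply, smul_eq_mul, Complex.ofReal_mul]
      ring
  rw [h2, smul_dotProduct, smul_eq_mul]
  field_simp

lemma convexHull_range_comp_succAbove (p : Fin 3 → R3) :
    convexHull ℝ (Set.range (p ∘ (0 : Fin 3).succAbove)) = segment ℝ (p 1) (p 2) ∧
    convexHull ℝ (Set.range (p ∘ (1 : Fin 3).succAbove)) = segment ℝ (p 0) (p 2) ∧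
    convexHull ℝ (Set.range (p ∘ (2 : Fin 3).succAbove)) = segment ℝ (p 0) (p 1) := by
  have h : ∀ (a : Fin 3), Set.range (p ∘ a.succAbove) = {p (a.succAbove 0), p (a.succAbove 1)} :=
    fun a => by
      ext x
      simp [Fin.exists_fin_two, eq_comm]
  simp only [h, convexHull_pair]
  exact ⟨rfl, rfl, rfl⟩

lemma CurlApprox.const_sub {K : Set R3} {v w u : R3 → C3} (h : CurlApprox K v w)
    (hu : ContDiff ℝ 1 u) :
    CurlApprox K (fun x => u x - v x) (fun x => vcurl u x - w x) := by
  obtain ⟨f, hf, hfv, hfw⟩ := h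
  have hcurl : ∀ n x, vcurl (fun y => u y - f n y) x = vcurl u x - vcurl (f n) x := fun n x => by
    have h1 : ∀ i j, pd (fun y => (u y - f n y) i) j x =
        pd (fun y => u y i) j x - pd (fun y => f n y i) j x := fun i j =>
      pd_sub ((contDiff_pi.1 hu i).differentiable one_ne_zero x)
        ((contDiff_pi.1 (hf n) i).differentiable one_ne_zero x) j
    ext i
    fin_cases i <;> simp only [vcurl, h1] <;> simp <;> ring
  refine ⟨fun n x => u x - f n x, fun n => hu.sub (hf n), ?_, ?_⟩
  · rw [Metric.tendstoUniformlyOn_iff] at hfv ⊢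
    simpa only [dist_sub_left] using hfv
  · rw [Metric.tendstoUniformlyOn_iff] at hfw ⊢
    simpa only [hcurl, dist_sub_left] using hfw

lemma interior_tetrahedron_nonempty {vt : Fin 4 → R3} (hvt : AffineIndependent ℝ vt) :
    (interior (convexHull ℝ (Set.range vt))).Nonempty := by
  rw [interior_convexHull_nonempty_iff_affineSpan_eq_top,
    hvt.affineSpan_eq_top_iff_card_eq_finrank_add_one]
  simp

/-- The volume moments of the curl of a field with vanishing degrees of freedom. -/
lemma setAverage_curl_eq_zero {vt nrm : Fin 4 → R3} (hvt : AffineIndependent ℝ vt)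
    (hn_orth : ∀ σ, ∀ i, i ≠ σ → ∀ j, j ≠ σ → dotR (nrm σ) (vt i - vt j) = 0)
    (hn_out : ∀ σ, ∀ i, i ≠ σ → dotR (nrm σ) (vt σ - vt i) < 0) {n : ℤ} {e d : R3 → C3}
    (hed : CurlApprox (convexHull ℝ (Set.range vt)) e d)
    (hvol : ∀ q : R3 → C3, (∀ i, (fun x => q x i) ∈ polyFun (n - 1)) →
      ⨍ x in convexHull ℝ (Set.range vt), dotProduct (q x) (e x) = 0)
    (hface : ∀ σ : Fin 4, ∀ q : R3 → C3, (∀ i, (fun x => q x i) ∈ polyFun n) →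
      (∀ x, dotProduct (q x) (cR (nrm σ)) = 0) →
      ⨍ x in convexHull ℝ (Set.range (vt ∘ σ.succAbove)), dotProduct (q x) (e x)
        ∂μH[((2 : ℕ) : ℝ)] = 0)
    {q : R3 → C3} (hq : ∀ i, (fun x => q x i) ∈ polyFun n) :
    ⨍ x in convexHull ℝ (Set.range vt), dotProduct (q x) (d x) = 0 := by
  obtain ⟨κ, hκ⟩ := exists_setAverage_dotProduct_curl hvt hn_orth hn_out
  rw [hκ e d q hed (contDiff_of_forall_mem_polyFun hq), hvol _ (vcurl_mem_polyFun hq), zero_add]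
  refine Finset.sum_eq_zero fun σ _ => ?_
  rw [hface σ, mul_zero]
  · intro i
    simpa using cross_mem_polyFun (b := fun _ => cR (nrm σ)) hq (fun i => const_mem_polyFun _) i
  · intro x
    rw [dotProduct_comm, dot_cross_self]

/-- The normal face moments of the curl of a field with vanishing degrees of freedom. -/
lemma setAverage_normal_curl_eq_zero {vt : Fin 4 → R3} (hvt : AffineIndependent ℝ vt)
    {σ : Fin 4} {ν : R3} (hν : ∀ i, i ≠ σ → ∀ j, j ≠ σ → dotR ν (vt i - vt j) = 0)
    {n : ℤ} {e d : R3 → C3} (hed : CurlApprox (convexHull ℝ (Set.range vt)) e d)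
    (hface : ∀ q : R3 → C3, (∀ i, (fun x => q x i) ∈ polyFun (n - 1)) →
      (∀ x, dotProduct (q x) (cR ν) = 0) →
      ⨍ x in convexHull ℝ (Set.range (vt ∘ σ.succAbove)), dotProduct (q x) (e x)
        ∂μH[((2 : ℕ) : ℝ)] = 0)
    (hedge : ∀ i j : Fin 4, i ≠ j → ∀ q ∈ polyFun n,
      ⨍ x in segment ℝ (vt i) (vt j), dotProduct (q x • cR (vt j - vt i)) (e x)
        ∂μH[((1 : ℕ) : ℝ)] = 0)
    {q : R3 → ℂ} (hq : q ∈ polyFun n) :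
    ⨍ x in convexHull ℝ (Set.range (vt ∘ σ.succAbove)), dotProduct (q x • cR ν) (d x)
      ∂μH[((2 : ℕ) : ℝ)] = 0 := by
  have hp : AffineIndependent ℝ (vt ∘ σ.succAbove) := hvt.comp_embedding σ.succAboveEmb
  obtain ⟨κ, hκ⟩ := exists_setAverage_smul_curl hp
    (convexHull_mono (Set.range_comp_subset_range _ _)) (n := ν)
    fun i j => hν _ (Fin.succAbove_ne σ i) _ (Fin.succAbove_ne σ j)
  obtain ⟨h0, h1, h2⟩ := convexHull_range_comp_succAbove (vt ∘ σ.succAbove)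
  have hE : ∀ i j : Fin 3, i ≠ j → ⨍ x in segment ℝ ((vt ∘ σ.succAbove) i) ((vt ∘ σ.succAbove) j),
      dotProduct (q x • cR ((vt ∘ σ.succAbove) j - (vt ∘ σ.succAbove) i)) (e x)
        ∂μH[((1 : ℕ) : ℝ)] = 0 := fun i j hij =>
    hedge _ _ (Fin.succAbove_right_injective.ne hij) q hq
  rw [hκ e d q hed (contDiff_of_mem_polyFun hq), h0, h1, h2, hE 1 2 (by decide),
    hE 0 2 (by decide), hE 0 1 (by decide), hface]
  · simp
  · intro i
    simpa using cross_mem_polyFun (a := fun _ => cR ν) (b := fun x j => pd q j x)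
      (fun i => const_mem_polyFun _) (fun j => pd_mem_polyFun hq j) i
  · intro x
    rw [dotProduct_comm, dot_self_cross]

/-- Lemma 3.3.  Let `K` be a tetrahedron (with vertices `vt`, outward
unit face normals `nrm`), `s > 1/2` and `v ∈ H^s(curl;K)` — here modelled by `v` and its
weak curl `w` being continuous on `K`, so that all face and edge moments are meaningful.
Let `I_h^curl v ∈ [P_k(K)]³` be the curl-conforming interpolant of the second kind,
determined by the volume moments against `D_{k-2}(K)`, the tangential face moments against
`D_{k-1}(F)` and the edge moments against `P_k(E)` (eqs. (3.5)), and let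
`I_h^div(∇×v) ∈ D_k(K)` be the divergence-conforming interpolant of the first kind of
`∇×v`, determined by the volume moments against `[P_{k-2}(K)]³` and the normal face
moments against `P_{k-1}(F)` (eqs. (3.4)).  Then `∇×(I_h^curl v) = I_h^div(∇×v)` on `K`.
(Face polynomial spaces are realized as restrictions of the corresponding spaces on `ℝ³`,
`μH[2]` and `μH[1]` denote the surface and line (Hausdorff) measures.) -/
theorem curl_of_curl_interpolant_eq_div_interpolant_of_curl
    (k : ℕ) (hk : 1 ≤ k)
    -- the tetrahedron
    (vt : Fin 4 → R3) (hvt : AffineIndependent ℝ vt)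
    (K : Set R3) (hK : K = convexHull ℝ (Set.range vt))
    -- outward unit normals of the faces (face `σ` is opposite to vertex `σ`)
    (nrm : Fin 4 → R3)
    (hn_unit : ∀ σ, dotR (nrm σ) (nrm σ) = 1)
    (hn_orth : ∀ σ, ∀ i, i ≠ σ → ∀ j, j ≠ σ → dotR (nrm σ) (vt i - vt j) = 0)
    (hn_out : ∀ σ, ∀ i, i ≠ σ → dotR (nrm σ) (vt σ - vt i) < 0)
    -- `v ∈ H^s(curl;K)`, `s > 1/2`, with weak curl `w`; traces modelled by continuity
    (v w : R3 → C3)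
    (hv : ContinuousOn v K) (hw : ContinuousOn w K)
    (hcurl : IsWeakCurlOn v w (interior K))
    -- the curl-conforming interpolant `I_h^curl v ∈ [P_k(K)]³` of the second kind
    (Icurl : R3 → C3) (hIcurl_poly : VPolyDeg (k : ℤ) Icurl)
    -- (3.5a): volume moments against `D_{k-2}(K)`
    (hIc_vol : ∀ q : R3 → C3, DSpace ((k : ℤ) - 2) q →
        ∫ x in K, dotC (Icurl x - v x) (q x) = 0)
    -- (3.5b): tangential face moments against `D_{k-1}(F)`
    (hIc_face : ∀ σ : Fin 4, ∀ q : R3 → C3, DSpace ((k : ℤ) - 1) q →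
        ∫ x in convexHull ℝ (vt '' {i | i ≠ σ}),
          dotC (tang (nrm σ) (Icurl x - v x)) (q x) ∂(μH[2]) = 0)
    -- (3.5c): edge moments against `P_k(E)` (with unit edge tangents)
    (hIc_edge : ∀ i j : Fin 4, i ≠ j → ∀ q : R3 → ℂ, PolyDeg (k : ℤ) q →
        ∫ x in segment ℝ (vt i) (vt j),
          ndot ((Real.sqrt (dotR (vt j - vt i) (vt j - vt i)))⁻¹ • (vt j - vt i))
              (Icurl x - v x) * (starRingEnd ℂ) (q x) ∂(μH[1]) = 0)
    -- the divergence-conforming interpolant `I_h^div(∇×v) ∈ D_k(K)` of the first kind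
    (Idiv : R3 → C3) (hIdiv_poly : DSpace (k : ℤ) Idiv)
    -- (3.4a): volume moments against `[P_{k-2}(K)]³`
    (hId_vol : ∀ q : R3 → C3, VPolyDeg ((k : ℤ) - 2) q →
        ∫ x in K, dotC (Idiv x - w x) (q x) = 0)
    -- (3.4b): normal face moments against `P_{k-1}(F)`
    (hId_face : ∀ σ : Fin 4, ∀ q : R3 → ℂ, PolyDeg ((k : ℤ) - 1) q →
        ∫ x in convexHull ℝ (vt '' {i | i ≠ σ}),
          ndot (nrm σ) (Idiv x - w x) * (starRingEnd ℂ) (q x) ∂(μH[2]) = 0) :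
    ∀ x ∈ K, vcurl Icurl x = Idiv x := by
  subst hK
  obtain ⟨g, φ, hg, hφ, hIdiv⟩ := hIdiv_poly
  have hIc : ∀ i, (fun x => Icurl x i) ∈ polyFun (k : ℤ) := fun i => (hIcurl_poly i).mem_polyFun
  have hIcd := contDiff_of_forall_mem_polyFun hIc
  have hIdivd : ContDiff ℝ 1 Idiv := by
    refine contDiff_of_forall_mem_polyFun (n := (k : ℤ) - 1 + 1) fun i => ?_
    simp only [hIdiv]
    exact add_mem_polyFun (polyFun_mono (by omega) (hg i).mem_polyFun)
      (mul_mem_polyFun hφ.mem_polyFun (coord_mem_polyFun i))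
  have himage : ∀ σ : Fin 4, vt '' {i | i ≠ σ} = Set.range (vt ∘ σ.succAbove) := fun σ => by
    rw [Set.range_comp, Fin.range_succAbove]
    rfl
  simp only [himage] at hIc_face hId_face
  rw [show (2 : ℝ) = ((2 : ℕ) : ℝ) by norm_num] at hIc_face hId_face
  have hc := isCompact_convexHull_range vt
  have hed := (curlApprox_of_isWeakCurlOn hc (convex_convexHull ℝ _)
    (interior_tetrahedron_nonempty hvt) hv hw hcurl).const_sub hIcd
  have hface : ∀ (σ : Fin 4) (q : R3 → C3),
      (∀ i, (fun x => q x i) ∈ polyFun ((k : ℤ) - 2)) →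
      (∀ x, dotProduct (q x) (cR (nrm σ)) = 0) →
      ⨍ x in convexHull ℝ (Set.range (vt ∘ σ.succAbove)), dotProduct (q x) (Icurl x - v x)
        ∂μH[((2 : ℕ) : ℝ)] = 0 := fun σ q hq hqn => by
    have h := setAverage_dotProduct_eq_zero_of_moments (n := (k : ℤ) - 1 - 1)
      (fun q hq => hIc_face σ q hq.dSpace) (fun i => polyFun_mono (by omega) (hq i))
    simpa only [dotProduct_tang (hqn _)] using h
  have hcurl_vol : ∀ q : R3 → C3, (∀ i, (fun x => q x i) ∈ polyFun ((k : ℤ) - 2)) →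
      ⨍ x in convexHull ℝ (Set.range vt), dotProduct (q x) (vcurl Icurl x - w x) = 0 :=
    fun q hq => setAverage_curl_eq_zero hvt hn_orth hn_out hed
      (fun q hq => setAverage_dotProduct_eq_zero_of_moments
        (fun q hq => hIc_vol q hq.dSpace) hq) hface hq
  have hcurl_face : ∀ σ : Fin 4, ∀ q ∈ polyFun ((k : ℤ) - 1),
      ⨍ x in convexHull ℝ (Set.range (vt ∘ σ.succAbove)),
        dotProduct (q x • cR (nrm σ)) (vcurl Icurl x - w x) ∂μH[((2 : ℕ) : ℝ)] = 0 :=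
    fun σ q hq => setAverage_normal_curl_eq_zero hvt (hn_orth σ) hed
      (fun q hq => hface σ q fun i => polyFun_mono (by omega) (hq i))
      (fun i j hij q hq => setAverage_segment_eq_zero_of_moments (hvt.injective.ne hij)
        (hIc_edge i j hij) (polyFun_mono (by omega) hq)) hq
  have hsplit : ∀ {m : ℕ} {p : Fin (m + 1) → R3}, AffineIndependent ℝ p →
      convexHull ℝ (Set.range p) ⊆ convexHull ℝ (Set.range vt) → ∀ {q : R3 → C3}, Continuous q →
      ⨍ x in convexHull ℝ (Set.range p), dotProduct (q x) (Idiv x - w x) ∂μH[(m : ℝ)] = 0 →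
      ⨍ x in convexHull ℝ (Set.range p), dotProduct (q x) (vcurl Icurl x - w x) ∂μH[(m : ℝ)] = 0 →
      ⨍ x in convexHull ℝ (Set.range p), dotProduct (q x) (Idiv x - vcurl Icurl x)
        ∂μH[(m : ℝ)] = 0 := fun {m p} hp hpK {q} hq h1 h2 => by
    have h3 : ∀ x, dotProduct (q x) (Idiv x - vcurl Icurl x) =
        dotProduct (q x) (Idiv x - w x) - dotProduct (q x) (vcurl Icurl x - w x) := fun x => by
      rw [← dotProduct_sub, sub_sub_sub_cancel_right]
    simp only [h3, setAverage_eq] at h1 h2 ⊢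
    rw [integral_sub, smul_sub, h1, h2, sub_zero]
    · exact integrableOn_dotProduct hp hq (hIdivd.continuous.continuousOn.sub (hw.mono hpK))
    · exact integrableOn_dotProduct hp hq
        ((continuous_vcurl hIcd).continuousOn.sub (hw.mono hpK))
  have h0 := eq_zero_of_moments hvt hn_orth hn_out (p := fun x => Idiv x - vcurl Icurl x)
    (g := fun x => g x - vcurl Icurl x)
    (fun i => sub_mem_polyFun (hg i).mem_polyFun (vcurl_mem_polyFun hIc i)) hφ
    (fun x => by
      ext i
      simp only [hIdiv, Pi.sub_apply]
      ring)
    (fun q hq => by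
      have h := hcurl_vol q fun i => polyFun_mono (by omega) (hq i)
      have h' := setAverage_dotProduct_eq_zero_of_moments hId_vol (q := q)
        fun i => polyFun_mono (by omega) (hq i)
      rw [← hausdorffMeasure_three_eq_volume] at h h' ⊢
      exact hsplit hvt subset_rfl (contDiff_of_forall_mem_polyFun hq).continuous h' h)
    (fun σ q hq => by
      refine hsplit (hvt.comp_embedding σ.succAboveEmb)
        (convexHull_mono (Set.range_comp_subset_range _ _))
        ((contDiff_of_mem_polyFun hq).continuous.smul continuous_const) ?_ (hcurl_face σ q hq)
      rw [← setAverage_mul_eq_zero_of_moments (hId_face σ) hq]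
      congr 1
      ext x
      rw [smul_dotProduct]
      rfl)
  exact fun x _ => (sub_eq_zero.1 (congrFun h0 x)).symm
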